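/- Let d ≥ 2 and P(ω_b > 0) > p_c(d). Then almost surely on the event {0 ∈ C_∞} there exists C(ω) > 0 such that the return probability satisfies P_{ω,0}(X_{2n} = 0) ≥ C(ω) / n^{d/2} for all n ≥ 1. (This follows from the quenched invariance principle via the reversibility bound P_{ω,0}(X_{2n}=0) ≥ P_{ω,0}(|X_n| ≤ √n)² / |C_∞ ∩ [−√n, √n]^d| and the spatial ergodic theorem.) -/

import Mathlib

open MeasureTheory ProbabilityTheory Filter Topology
open scoped ENNReal NNReal BigOperators
open scoped Classical

noncomputable section
namespace RCRW

/-- Sites of the lattice `ℤ^d`. -/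
abbrev Site (d : ℕ) := Fin d → ℤ

/-- Nearest-neighbour edges of `ℤ^d`, encoded by their base point and direction. -/
abbrev Edge (d : ℕ) := (Fin d → ℤ) × Fin d

/-- Environments: an assignment of a conductance to every edge. -/
abbrev Env (d : ℕ) := Edge d → ℝ

/-- Euclidean space `ℝ^d`. -/
abbrev Euc (d : ℕ) := EuclideanSpace ℝ (Fin d)

/-- The `i`-th coordinate unit vector of `ℤ^d`. -/
def unitE (d : ℕ) (i : Fin d) : Site d := fun j => if j = i then 1 else 0

/-- Canonical embedding `ℤ^d → ℝ^d`. -/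
def emb (d : ℕ) (x : Site d) : Euc d := (EuclideanSpace.equiv (Fin d) ℝ).symm fun i => (x i : ℝ)

/-- `x` and `y` are nearest neighbours in `ℤ^d`. -/
def adjacent (d : ℕ) (x y : Site d) : Prop :=
  (∃ i, y = x + unitE d i) ∨ (∃ i, x = y + unitE d i)

/-- The conductance of the (unordered) edge between `x` and `y` (zero if not an edge). -/
def condOf (d : ℕ) (ω : Env d) (x y : Site d) : ℝ :=
  if h : ∃ i, y = x + unitE d i then ω (x, h.choose)
  else if h2 : ∃ i, x = y + unitE d i then ω (y, h2.choose)
  else 0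

/-- The shift of the environment by a lattice vector `z`. -/
def shiftBy (d : ℕ) (z : Site d) (ω : Env d) : Env d := fun e => ω (e.1 + z, e.2)

/-- Two sites are linked by an edge of positive conductance. -/
def openRel (d : ℕ) (ω : Env d) (a b : Site d) : Prop :=
  adjacent d a b ∧ 0 < condOf d ω a b

/-- Two sites are linked by an edge of conductance at least `α`. -/
def geRel (d : ℕ) (ω : Env d) (α : ℝ) (a b : Site d) : Prop :=
  adjacent d a b ∧ α ≤ condOf d ω a b

/-- The infinite cluster `C∞` of edges with positive conductance: the set of sites whose
open-cluster is infinite. -/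
def Cinf (d : ℕ) (ω : Env d) : Set (Site d) :=
  {x | {y | Relation.ReflTransGen (openRel d ω) x y}.Infinite}

/-- `C∞,α`: the set of sites connected to infinity by edges of conductance `≥ α`. -/
def Cinfa (d : ℕ) (ω : Env d) (α : ℝ) : Set (Site d) :=
  {x | {y | Relation.ReflTransGen (geRel d ω α) x y}.Infinite}

/-- `P` is the law of i.i.d. random variables indexed by `ι` with one-coordinate marginal `μ`. -/
def IsIIDLaw {ι : Type*} (P : Measure (ι → ℝ)) (μ : Measure ℝ) : Prop :=
  IsProbabilityMeasure P ∧
    ∀ (s : Finset ι) (f : ι → Set ℝ), (∀ i, MeasurableSet (f i)) →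
      P {ω | ∀ i ∈ s, ω i ∈ f i} = ∏ i ∈ s, μ (f i)

/-- The Bernoulli measure on `ℝ` with mass `p` at `1` and `1 - p` at `0`. -/
def bern (p : ℝ) : Measure ℝ :=
  ENNReal.ofReal p • Measure.dirac 1 + ENNReal.ofReal (1 - p) • Measure.dirac 0

/-- The bond-percolation threshold `p_c(d)` of `ℤ^d`. -/
def pc (d : ℕ) : ℝ :=
  sInf {p : ℝ | 0 ≤ p ∧ p ≤ 1 ∧
    ∀ P : Measure (Env d), IsIIDLaw P (bern p) → 0 < P {ω | (0 : Site d) ∈ Cinf d ω}}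

/-- Total conductance emanating from `x`. -/
def degSum (d : ℕ) (ω : Env d) (x : Site d) : ℝ :=
  ∑ i : Fin d, (condOf d ω x (x + unitE d i) + condOf d ω x (x - unitE d i))

/-- One-step transition probabilities of the (lazy) random walk among conductances. -/
def stepProb (d : ℕ) (ω : Env d) (x y : Site d) : ℝ :=
  if adjacent d x y then condOf d ω x y / (2 * d)
  else if y = x then 1 - degSum d ω x / (2 * d)
  else 0

/-- `Pz` is the quenched path law `P_{ω,z}` of the walk among the conductances `ω`
started at `z`, characterized through its cylinder probabilities. -/
def IsQuenchedLaw (d : ℕ) (ω : Env d) (z : Site d) (Pz : Measure (ℕ → Site d)) : Prop :=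
  IsProbabilityMeasure Pz ∧
    ∀ (n : ℕ) (γ : ℕ → Site d),
      Pz {X | ∀ k ≤ n, X k = γ k} =
        ENNReal.ofReal ((if γ 0 = z then (1 : ℝ) else 0) *
          ∏ k ∈ Finset.range n, stepProb d ω (γ k) (γ (k + 1)))

/-- `ω̂_{xy} = P_{ω,x}(X_{T₁} = y)`: the probability that the walk started at `x` enters
`C∞,α` for the first time (after time `0`) at the site `y`; written as a sum over paths. -/
def hatStep (d : ℕ) (ω : Env d) (α : ℝ) (x y : Site d) : ℝ :=
  ∑' n : ℕ, ∑' γ : Fin (n + 2) → Site d,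
    if γ 0 = x ∧ γ (Fin.last (n + 1)) = y ∧ y ∈ Cinfa d ω α ∧
        (∀ k : Fin (n + 2), k ≠ 0 → k ≠ Fin.last (n + 1) → γ k ∉ Cinfa d ω α)
    then ∏ k : Fin (n + 1), stepProb d ω (γ k.castSucc) (γ k.succ)
    else 0

/-- `n`-step kernel of the induced walk on `C∞,α`. -/
def hatPow (d : ℕ) (ω : Env d) (α : ℝ) : ℕ → Site d → Site d → ℝ
  | 0 => fun x y => if x = y then 1 else 0
  | n + 1 => fun x y => ∑' z : Site d, hatPow d ω α n x z * hatStep d ω α z y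

/-- `P_{ω,x}(Y_t = y)` for the continuous-time random walk `Y` on `C∞,α` with
generator `L_ω^{(α)}` (rate-one jumps with kernel `ω̂`). -/
def ctKernel (d : ℕ) (ω : Env d) (α : ℝ) (t : ℝ) (x y : Site d) : ℝ :=
  ∑' n : ℕ, (Real.exp (-t) * t ^ n / n.factorial) * hatPow d ω α n x y

/-- `E_{ω,x}|Y_t - x|`: expected (Euclidean) displacement of the continuous-time walk. -/
def expDist (d : ℕ) (ω : Env d) (α : ℝ) (t : ℝ) (x : Site d) : ℝ :=
  ∑' y : Site d, ctKernel d ω α t x y * ‖emb d y - emb d x‖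

/-- The generator `L_ω^{(α)}` acting on vector-valued functions. -/
def genLa (d : ℕ) (ω : Env d) (α : ℝ) (f : Site d → Euc d) (x : Site d) : Euc d :=
  ∑' y : Site d, hatStep d ω α x y • (f y - f x)

/-- The generator `L_ω` of the walk among conductances on `ℤ^d`, acting on
vector-valued functions. -/
def latOp (d : ℕ) (ω : Env d) (f : Site d → Euc d) (x : Site d) : Euc d :=
  (2 * (d : ℝ))⁻¹ • ∑ i : Fin d,
    (condOf d ω x (x + unitE d i) • (f (x + unitE d i) - f x) +
      condOf d ω x (x - unitE d i) • (f (x - unitE d i) - f x))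

/-- `max_{x ∈ C∞,α, |x| ≤ n} |ψ(x)|`. -/
def maxPsi (d : ℕ) (ω : Env d) (α : ℝ) (ψ : Site d → Euc d) (n : ℝ) : ℝ :=
  sSup ((fun x => ‖ψ x‖) '' {x : Site d | x ∈ Cinfa d ω α ∧ ‖emb d x‖ ≤ n})

/-- The number of sites `x ∈ C∞,α` with `|x| ≤ n` at which `|ψ(x)| ≥ ε n`. -/
def badCount (d : ℕ) (ω : Env d) (α : ℝ) (ψ : Site d → Euc d) (ε : ℝ) (n : ℕ) : ℕ :=
  Nat.card {x : Site d // x ∈ Cinfa d ω α ∧ ‖emb d x‖ ≤ n ∧ ε * n ≤ ‖ψ x‖}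

/-- Lengths of paths from `x` to `y` using only edges of conductance `≥ α`
(graph distance on `C∞,α` is the least element of this set). -/
def gdSet (d : ℕ) (ω : Env d) (α : ℝ) (x y : Site d) : Set ℕ :=
  {n | ∃ γ : Fin (n + 1) → Site d, γ 0 = x ∧ γ (Fin.last n) = y ∧
    ∀ k : Fin n, geRel d ω α (γ k.castSucc) (γ k.succ)}

/-- The graph distance on `C∞,α` (with value `∞` if there is no path). -/
def gdA (d : ℕ) (ω : Env d) (α : ℝ) (x y : Site d) : ℝ≥0∞ :=
  sInf ((fun n : ℕ => (n : ℝ≥0∞)) '' gdSet d ω α x y)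

/-- Lengths of "jump paths" available to the walk `Y` on `C∞,α`: consecutive points are
linked by a jump of positive probability `ω̂ > 0`.  The jump distance `d(x,y)` of the
walk `Y` is the least element of this set. -/
def jumpDistSet (d : ℕ) (ω : Env d) (α : ℝ) (x y : Site d) : Set ℕ :=
  {n | ∃ γ : Fin (n + 1) → Site d, γ 0 = x ∧ γ (Fin.last n) = y ∧
    ∀ k : Fin n, 0 < hatStep d ω α (γ k.castSucc) (γ k.succ)}

/-- The relation defining the components of `C∞ \ C∞,α`. -/
def weakRel (d : ℕ) (ω : Env d) (α : ℝ) (a b : Site d) : Prop :=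
  adjacent d a b ∧ 0 < condOf d ω a b ∧
    a ∈ Cinf d ω \ Cinfa d ω α ∧ b ∈ Cinf d ω \ Cinfa d ω α

/-- `F(x)`: the connected component of `C∞ \ C∞,α` containing `x` (empty if
`x ∉ C∞ \ C∞,α`). -/
def Fcomp (d : ℕ) (ω : Env d) (α : ℝ) (x : Site d) : Set (Site d) :=
  {y | x ∈ Cinf d ω \ Cinfa d ω α ∧ Relation.ReflTransGen (weakRel d ω α) x y}

/-- The `ℓ^∞` distance on `ℤ^d` (as a natural number). -/
def linfDist (d : ℕ) (x y : Site d) : ℕ :=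
  Finset.univ.sup fun i => (x i - y i).natAbs


/-! ### The generator of the walk and its resolvent -/

section Resolvent

/-- All conductances lie in `[0, 1]`. -/
def UnitCond {d : ℕ} (w : Env d) : Prop := ∀ e, 0 ≤ w e ∧ w e ≤ 1

/-- The generator of the walk among the conductances `w`, acting on real functions. -/
def gen {d : ℕ} (w : Env d) (F : Site d → ℝ) (x : Site d) : ℝ :=
  (2 * (d : ℝ))⁻¹ * ∑ i : Fin d, (w (x, i) * (F (x + unitE d i) - F x) +
    w (x - unitE d i, i) * (F (x - unitE d i) - F x))

/-- The transition operator of the walk among the conductances `w`. -/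
def step {d : ℕ} (w : Env d) (F : Site d → ℝ) (x : Site d) : ℝ := F x + gen w F x

/-- The expectation of `F` at a geometric time of mean `1 / ε`, as a function of the start. -/
def geoAvg {d : ℕ} (w : Env d) (ε : ℝ) (F : Site d → ℝ) (x : Site d) : ℝ :=
  ∑' j : ℕ, ε / (1 + ε) * (1 / (1 + ε)) ^ j * ((step w)^[j] F) x

/-- Functions of at most quadratic growth. -/
def QuadGrowth {d : ℕ} (F : Site d → ℝ) : Prop := ∃ C : ℝ, ∀ x, |F x| ≤ C * (1 + ‖x‖) ^ 2

variable {d : ℕ} {w : Env d} {F G : Site d → ℝ} {ε : ℝ}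

lemma norm_unitE_le (i : Fin d) : ‖unitE d i‖ ≤ 1 := by
  refine (pi_norm_le_iff_of_nonneg zero_le_one).2 fun j => ?_
  unfold unitE
  split_ifs <;> simp

lemma gen_add (F G : Site d → ℝ) : gen w (F + G) = gen w F + gen w G := by
  funext x
  simp only [gen, Pi.add_apply, ← mul_add, ← Finset.sum_add_distrib]
  congr 1
  exact Finset.sum_congr rfl fun i _ => by ring

lemma gen_smul (c : ℝ) (F : Site d → ℝ) : gen w (c • F) = c • gen w F := by
  funext x
  simp only [gen, Pi.smul_apply, smul_eq_mul, Finset.mul_sum]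
  exact Finset.sum_congr rfl fun i _ => by ring

lemma step_eq (F : Site d → ℝ) : step w F = F + gen w F := rfl

lemma step_add (F G : Site d → ℝ) : step w (F + G) = step w F + step w G := by
  simp only [step_eq, gen_add]; abel

lemma step_smul (c : ℝ) (F : Site d → ℝ) : step w (c • F) = c • step w F := by
  simp only [step_eq, gen_smul, smul_add]

lemma iterate_step_add (F G : Site d → ℝ) (j : ℕ) :
    (step w)^[j] (F + G) = (step w)^[j] F + (step w)^[j] G := by
  induction j with
  | zero => rfl
  | succ j ih => simp only [Function.iterate_succ', Function.comp_apply, ih, step_add]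

lemma iterate_step_smul (c : ℝ) (F : Site d → ℝ) (j : ℕ) :
    (step w)^[j] (c • F) = c • (step w)^[j] F := by
  induction j with
  | zero => rfl
  | succ j ih => simp only [Function.iterate_succ', Function.comp_apply, ih, step_smul]

lemma step_le (hw : UnitCond w) {x : Site d} {K : ℝ} (h : ∀ y, ‖y - x‖ ≤ 1 → F y ≤ K) :
    step w F x ≤ K := by
  have h0 : 0 ≤ K - F x := sub_nonneg.2 (h x (by simp))
  have hterm : ∀ i : Fin d, w (x, i) * (F (x + unitE d i) - F x) +
      w (x - unitE d i, i) * (F (x - unitE d i) - F x) ≤ 2 * (K - F x) := by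
    intro i
    have h1 := h (x + unitE d i) (by simpa using norm_unitE_le i)
    have h2 := h (x - unitE d i) (by simpa using norm_unitE_le i)
    nlinarith [hw (x, i), hw (x - unitE d i, i),
      mul_le_mul_of_nonneg_left (sub_le_sub_right h1 (F x)) (hw (x, i)).1,
      mul_le_mul_of_nonneg_left (sub_le_sub_right h2 (F x)) (hw (x - unitE d i, i)).1,
      mul_nonneg (sub_nonneg.2 (hw (x, i)).2) h0,
      mul_nonneg (sub_nonneg.2 (hw (x - unitE d i, i)).2) h0]
  have hsum := Finset.sum_le_sum fun i (_ : i ∈ Finset.univ) => hterm i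
  simp only [Finset.sum_const, Finset.card_univ, Fintype.card_fin, nsmul_eq_mul] at hsum
  have hD : (0 : ℝ) ≤ (2 * (d : ℝ))⁻¹ := by positivity
  have h3 := mul_le_mul_of_nonneg_left hsum hD
  have h4 : (2 * (d : ℝ))⁻¹ * (d * (2 * (K - F x))) ≤ K - F x := by
    have : (2 * (d : ℝ))⁻¹ * (2 * d) ≤ 1 := inv_mul_le_one
    nlinarith [mul_le_mul_of_nonneg_right this h0]
  unfold step gen
  linarith

lemma step_mono (hw : UnitCond w) (h : ∀ x, F x ≤ G x) (x : Site d) :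
    step w F x ≤ step w G x := by
  have h1 : step w (F + (-1 : ℝ) • G) x ≤ 0 := step_le hw fun y _ => by
    simpa using h y
  rw [step_add, step_smul] at h1
  simpa using h1

lemma iterate_step_mono (hw : UnitCond w) (h : ∀ x, F x ≤ G x) (j : ℕ) (x : Site d) :
    (step w)^[j] F x ≤ (step w)^[j] G x := by
  induction j generalizing x with
  | zero => exact h x
  | succ j ih =>
    simp only [Function.iterate_succ', Function.comp_apply]
    exact step_mono hw ih x

lemma iterate_step_const (c : ℝ) (j : ℕ) : (step w)^[j] (fun _ => c) = fun _ => c := by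
  induction j with
  | zero => rfl
  | succ j ih =>
    simp only [Function.iterate_succ', Function.comp_apply, ih]
    funext x
    simp [step, gen]

lemma iterate_step_abs_le (hw : UnitCond w) {C : ℝ} (hC : ∀ x, |F x| ≤ C * (1 + ‖x‖) ^ 2)
    (j : ℕ) (x : Site d) : |(step w)^[j] F x| ≤ C * (1 + ‖x‖ + j) ^ 2 := by
  have hC0 : 0 ≤ C := by
    have := (abs_nonneg _).trans (hC 0)
    simpa using this
  induction j generalizing x with
  | zero => simpa using hC x
  | succ j ih =>
    simp only [Function.iterate_succ', Function.comp_apply]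
    set H := (step w)^[j] F
    have key : ∀ y, ‖y - x‖ ≤ 1 → |H y| ≤ C * (1 + ‖x‖ + (j + 1 : ℕ)) ^ 2 := by
      intro y hy
      refine (ih y).trans ?_
      have h1 : ‖y‖ ≤ ‖x‖ + 1 := by
        have := norm_add_le (y - x) x
        rw [sub_add_cancel] at this
        linarith
      push_cast
      gcongr ?_ * ?_ ^ 2
      linarith
    rw [abs_le]
    constructor
    · have := step_le (F := (-1 : ℝ) • H) (K := C * (1 + ‖x‖ + (j + 1 : ℕ)) ^ 2) hw (x := x)
        fun y hy => by
          have := neg_le_abs (H y)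
          have h2 := key y hy
          simp only [Pi.smul_apply, smul_eq_mul]
          linarith
      rw [step_smul] at this
      simp only [Pi.smul_apply, smul_eq_mul] at this
      linarith
    · exact step_le hw fun y hy => (le_abs_self _).trans (key y hy)

lemma QuadGrowth.of_bounded {C : ℝ} (h : ∀ x, |F x| ≤ C) : QuadGrowth F := by
  have hC : 0 ≤ C := (abs_nonneg _).trans (h 0)
  refine ⟨C, fun x => (h x).trans ?_⟩
  have : (1 : ℝ) ≤ (1 + ‖x‖) ^ 2 := by nlinarith [norm_nonneg x]
  nlinarith

lemma QuadGrowth.add (hF : QuadGrowth F) (hG : QuadGrowth G) : QuadGrowth (F + G) := by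
  obtain ⟨A, hA⟩ := hF
  obtain ⟨B, hB⟩ := hG
  refine ⟨A + B, fun x => ?_⟩
  have := abs_add_le (F x) (G x)
  simp only [Pi.add_apply]
  linarith [hA x, hB x]

lemma QuadGrowth.smul (c : ℝ) (hF : QuadGrowth F) : QuadGrowth (c • F) := by
  obtain ⟨A, hA⟩ := hF
  refine ⟨|c| * A, fun x => ?_⟩
  simp only [Pi.smul_apply, smul_eq_mul, abs_mul]
  rw [mul_assoc]
  exact mul_le_mul_of_nonneg_left (hA x) (abs_nonneg c)

lemma QuadGrowth.mul_of_linear {A B : ℝ} (hF : ∀ x, |F x| ≤ A * (1 + ‖x‖))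
    (hG : ∀ x, |G x| ≤ B * (1 + ‖x‖)) : QuadGrowth (F * G) := by
  refine ⟨A * B, fun x => ?_⟩
  have h := mul_le_mul (hF x) (hG x) (abs_nonneg _) ((abs_nonneg _).trans (hF x))
  rw [Pi.mul_apply, abs_mul]
  linarith

lemma QuadGrowth.step (hw : UnitCond w) (hF : QuadGrowth F) : QuadGrowth (step w F) := by
  obtain ⟨C, hC⟩ := hF
  have hC0 : 0 ≤ C := by
    have := (abs_nonneg _).trans (hC 0)
    simpa using this
  refine ⟨4 * C, fun x => ?_⟩
  have := iterate_step_abs_le hw hC 1 x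
  simp only [Function.iterate_one, Nat.cast_one] at this
  refine this.trans ?_
  have h1 : (1 + ‖x‖ + 1) ^ 2 ≤ 4 * (1 + ‖x‖) ^ 2 := by nlinarith [norm_nonneg x]
  nlinarith

lemma gen_eq (F : Site d → ℝ) : gen w F = step w F + (-1 : ℝ) • F := by
  funext x; simp [step]

lemma QuadGrowth.gen (hw : UnitCond w) (hF : QuadGrowth F) : QuadGrowth (gen w F) := by
  rw [gen_eq]
  exact (hF.step hw).add (hF.smul _)

lemma summable_geo (hε : 0 < ε) (a : ℝ) :
    Summable fun j : ℕ => (1 / (1 + ε)) ^ j * (a + j) ^ 2 := by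
  have hr : ‖(1 / (1 + ε) : ℝ)‖ < 1 := by
    rw [Real.norm_of_nonneg (by positivity), div_lt_one (by positivity)]
    linarith
  have h := fun k => summable_pow_mul_geometric_of_norm_lt_one k hr
  refine (((h 2).add ((h 1).mul_left (2 * a))).add ((h 0).mul_left (a ^ 2))).congr fun j => ?_
  simp only [pow_zero, pow_one]
  ring

lemma summable_geoAvg (hw : UnitCond w) (hε : 0 < ε) (hF : QuadGrowth F) (x : Site d) :
    Summable fun j : ℕ => ε / (1 + ε) * (1 / (1 + ε)) ^ j * ((step w)^[j] F) x := by
  obtain ⟨C, hC⟩ := hF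
  refine Summable.of_norm_bounded
    ((summable_geo hε (1 + ‖x‖)).mul_left (ε / (1 + ε) * C)) fun j => ?_
  rw [Real.norm_eq_abs, abs_mul, abs_of_nonneg (by positivity)]
  have := iterate_step_abs_le hw hC j x
  calc _ ≤ ε / (1 + ε) * (1 / (1 + ε)) ^ j * (C * (1 + ‖x‖ + j) ^ 2) := by gcongr
    _ = _ := by ring

lemma geoAvg_add (hw : UnitCond w) (hε : 0 < ε) (hF : QuadGrowth F) (hG : QuadGrowth G) :
    geoAvg w ε (F + G) = geoAvg w ε F + geoAvg w ε G := by
  funext x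
  simp only [geoAvg, Pi.add_apply]
  rw [← (summable_geoAvg hw hε hF x).tsum_add (summable_geoAvg hw hε hG x)]
  refine tsum_congr fun j => ?_
  rw [iterate_step_add, Pi.add_apply, mul_add]

lemma geoAvg_smul (c : ℝ) (F : Site d → ℝ) : geoAvg w ε (c • F) = c • geoAvg w ε F := by
  funext x
  simp only [geoAvg, Pi.smul_apply, smul_eq_mul]
  rw [← tsum_mul_left]
  refine tsum_congr fun j => ?_
  rw [iterate_step_smul, Pi.smul_apply, smul_eq_mul]
  ring

lemma geoAvg_mono (hw : UnitCond w) (hε : 0 < ε) (hF : QuadGrowth F) (hG : QuadGrowth G)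
    (h : ∀ x, F x ≤ G x) (x : Site d) : geoAvg w ε F x ≤ geoAvg w ε G x := by
  refine (summable_geoAvg hw hε hF x).tsum_le_tsum (fun j => ?_) (summable_geoAvg hw hε hG x)
  exact mul_le_mul_of_nonneg_left (iterate_step_mono hw h j x) (by positivity)

lemma tsum_geo (hε : 0 < ε) : ∑' j : ℕ, ε / (1 + ε) * (1 / (1 + ε)) ^ j = 1 := by
  rw [tsum_mul_left, tsum_geometric_of_lt_one (by positivity)
    (by rw [div_lt_one (by positivity)]; linarith)]
  have : (1 + ε) ≠ 0 := by positivity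
  field_simp
  ring_nf
  field_simp

lemma geoAvg_const (hε : 0 < ε) (c : ℝ) : geoAvg w ε (fun _ => c) = fun _ => c := by
  funext x
  simp only [geoAvg, iterate_step_const]
  rw [tsum_mul_right, tsum_geo hε, one_mul]

lemma geoAvg_step (hw : UnitCond w) (hε : 0 < ε) (hF : QuadGrowth F) (x : Site d) :
    geoAvg w ε (step w F) x = (1 + ε) * geoAvg w ε F x - ε * F x := by
  have h := (summable_geoAvg hw hε hF x).tsum_eq_zero_add
  have h2 : ∑' j : ℕ, ε / (1 + ε) * (1 / (1 + ε)) ^ (j + 1) * ((step w)^[j + 1] F) x =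
      (1 / (1 + ε)) * geoAvg w ε (step w F) x := by
    rw [geoAvg, ← tsum_mul_left]
    refine tsum_congr fun j => ?_
    rw [Function.iterate_succ_apply, pow_succ]
    ring
  rw [h2] at h
  simp only [pow_zero, mul_one, Function.iterate_zero, id] at h
  change geoAvg w ε F x = _ at h
  have : (1 + ε) ≠ 0 := by positivity
  rw [h]
  field_simp
  ring

lemma geoAvg_gen (hw : UnitCond w) (hε : 0 < ε) (hF : QuadGrowth F) (x : Site d) :
    geoAvg w ε (gen w F) x = ε * (geoAvg w ε F x - F x) := by
  rw [gen_eq, geoAvg_add hw hε (hF.step hw) (hF.smul _), geoAvg_smul, Pi.add_apply,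
    geoAvg_step hw hε hF]
  simp only [Pi.smul_apply, smul_eq_mul]
  ring

lemma hasSum_step {f : ℕ → Site d → ℝ} {g : Site d → ℝ} (h : ∀ x, HasSum (fun j => f j x) (g x))
    (x : Site d) : HasSum (fun j => step w (f j) x) (step w g x) := by
  unfold step gen
  refine (h x).add (HasSum.mul_left _ (hasSum_sum fun i _ => ?_))
  exact (((h _).sub (h x)).mul_left _).add (((h _).sub (h x)).mul_left _)

lemma step_geoAvg (hw : UnitCond w) (hε : 0 < ε) (hF : QuadGrowth F) :
    step w (geoAvg w ε F) = geoAvg w ε (step w F) := by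
  funext x
  have h := hasSum_step (w := w)
    (f := fun j x => ε / (1 + ε) * (1 / (1 + ε)) ^ j * ((step w)^[j] F) x) (g := geoAvg w ε F)
    (fun y => (summable_geoAvg hw hε hF y).hasSum) x
  rw [← h.tsum_eq, geoAvg]
  refine tsum_congr fun j => ?_
  have : (fun y => ε / (1 + ε) * (1 / (1 + ε)) ^ j * ((step w)^[j] F) y) =
    (ε / (1 + ε) * (1 / (1 + ε)) ^ j) • ((step w)^[j] F) := rfl
  rw [this, step_smul, Pi.smul_apply, smul_eq_mul, ← Function.iterate_succ_apply' (step w) j F,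
    Function.iterate_succ_apply]

lemma gen_geoAvg (hw : UnitCond w) (hε : 0 < ε) (hF : QuadGrowth F) (x : Site d) :
    gen w (geoAvg w ε F) x = ε * (geoAvg w ε F x - F x) := by
  rw [gen_eq, step_geoAvg hw hε hF, Pi.add_apply, geoAvg_step hw hε hF]
  simp only [Pi.smul_apply, smul_eq_mul]
  ring

lemma abs_geoAvg_le (hw : UnitCond w) (hε : 0 < ε) {C : ℝ} (h : ∀ x, |F x| ≤ C) (x : Site d) :
    |geoAvg w ε F x| ≤ C := by
  have hF := QuadGrowth.of_bounded h
  have hC := fun c : ℝ => QuadGrowth.of_bounded (d := d) (F := fun _ => c) (C := |c|)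
    fun _ => le_rfl
  rw [abs_le]
  constructor
  · have := geoAvg_mono hw hε (hC (-C)) hF (fun x => (abs_le.1 (h x)).1) x
    rwa [geoAvg_const hε] at this
  · have := geoAvg_mono hw hε hF (hC C) (fun x => (abs_le.1 (h x)).2) x
    rwa [geoAvg_const hε] at this

/-! ### The corrected coordinate and the quenched second moment bound -/

/-- The `c`-th coordinate as a real function. -/
def coordFn (c : Fin d) (x : Site d) : ℝ := x c

/-- The local drift of the walk in direction `c`. -/
def drift (w : Env d) (c : Fin d) : Site d → ℝ := gen w (coordFn c)

/-- The approximate corrector, solving `(ε - L) b = drift`. -/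
def corr (w : Env d) (c : Fin d) (ε : ℝ) : Site d → ℝ := ε⁻¹ • geoAvg w ε (drift w c)

/-- The divergence in direction `c` of the flow carrying the conductance times the edge mean
of `b`. -/
def meanDiv (w : Env d) (c : Fin d) (b : Site d → ℝ) (x : Site d) : ℝ :=
  (2 * (d : ℝ))⁻¹ * (w (x, c) * ((b x + b (x + unitE d c)) / 2) -
    w (x - unitE d c, c) * ((b (x - unitE d c) + b x) / 2))

lemma coordFn_add (c : Fin d) (x y : Site d) : coordFn c (x + y) = coordFn c x + coordFn c y := by
  simp [coordFn]

lemma coordFn_sub (c : Fin d) (x y : Site d) : coordFn c (x - y) = coordFn c x - coordFn c y := by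
  simp [coordFn]

lemma coordFn_unitE (c i : Fin d) : coordFn c (unitE d i) = if c = i then 1 else 0 := by
  simp [coordFn, unitE]

lemma drift_eq (c : Fin d) (x : Site d) :
    drift w c x = (2 * (d : ℝ))⁻¹ * (w (x, c) - w (x - unitE d c, c)) := by
  unfold drift gen
  congr 1
  rw [Finset.sum_eq_single c]
  · rw [coordFn_add, coordFn_sub, coordFn_unitE, if_pos rfl]
    ring
  · intro i _ hi
    rw [coordFn_add, coordFn_sub, coordFn_unitE, if_neg (Ne.symm hi)]
    ring
  · simp

lemma abs_drift_le (hw : UnitCond w) (c : Fin d) (x : Site d) : |drift w c x| ≤ 1 := by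
  rw [drift_eq, abs_mul, abs_of_nonneg (by positivity : (0 : ℝ) ≤ (2 * (d : ℝ))⁻¹)]
  have h1 : |w (x, c) - w (x - unitE d c, c)| ≤ 1 := by
    rw [abs_le]
    constructor <;> linarith [(hw (x, c)).1, (hw (x, c)).2, (hw (x - unitE d c, c)).1,
      (hw (x - unitE d c, c)).2]
  have h2 : (2 * (d : ℝ))⁻¹ ≤ 1 := by
    refine inv_le_one_of_one_le₀ ?_
    have : (1 : ℝ) ≤ d := by exact_mod_cast c.pos
    linarith
  exact mul_le_one₀ h2 (abs_nonneg _) h1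

lemma abs_corr_le (hw : UnitCond w) (hε : 0 < ε) (c : Fin d) (x : Site d) :
    |corr w c ε x| ≤ ε⁻¹ := by
  have := abs_geoAvg_le hw hε (abs_drift_le hw c) x
  rw [corr, Pi.smul_apply, smul_eq_mul, abs_mul, abs_of_pos (inv_pos.2 hε)]
  exact mul_le_of_le_one_right (inv_pos.2 hε).le this

lemma gen_corr (hw : UnitCond w) (hε : 0 < ε) (c : Fin d) (x : Site d) :
    gen w (corr w c ε) x = ε * corr w c ε x - drift w c x := by
  rw [corr, gen_smul, Pi.smul_apply, gen_geoAvg hw hε (.of_bounded (abs_drift_le hw c))]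
  simp only [Pi.smul_apply, smul_eq_mul]
  field_simp

lemma abs_meanDiv_le (hw : UnitCond w) (c : Fin d) {b : Site d → ℝ} {C : ℝ}
    (hb : ∀ x, |b x| ≤ C) (x : Site d) : |meanDiv w c b x| ≤ 2 * C := by
  have key : ∀ y z e, |w e * ((b y + b z) / 2)| ≤ C := by
    intro y z e
    have h1 : |(b y + b z) / 2| ≤ C := by
      have := abs_le.1 (hb y)
      have := abs_le.1 (hb z)
      rw [abs_le]
      constructor <;> linarith
    rw [abs_mul, abs_of_nonneg (hw e).1]
    exact (mul_le_of_le_one_left (abs_nonneg _) (hw e).2).trans h1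
  have h2 : (2 * (d : ℝ))⁻¹ ≤ 1 := by
    refine inv_le_one_of_one_le₀ ?_
    have : (1 : ℝ) ≤ d := by exact_mod_cast c.pos
    linarith
  rw [meanDiv, abs_mul, abs_of_nonneg (by positivity : (0 : ℝ) ≤ (2 * (d : ℝ))⁻¹)]
  refine (mul_le_of_le_one_left (abs_nonneg _) h2).trans ((abs_sub _ _).trans ?_)
  linarith [key x (x + unitE d c) (x, c), key (x - unitE d c) x (x - unitE d c, c)]

/-- The pointwise inequality behind the second moment bound. -/
lemma half_sq_le (hw : UnitCond w) (hε : 0 < ε) (c : Fin d) (b₀ : ℝ) (x : Site d) :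
    let l := coordFn c
    let b := corr w c ε
    let T : Site d → ℝ := fun x => l x ^ 2 + 2 * (l x * b x) - (l x + b x - b₀) ^ 2 / 4
    ε * l x ^ 2 / 2 ≤ (ε * T x - gen w T x) + (ε * b₀ ^ 2 / 2 + 1) + 2 * meanDiv w c b x := by
  intro l b T
  set D : ℝ := (2 * (d : ℝ))⁻¹ with hD
  have hD0 : 0 ≤ D := by positivity
  have hLb : gen w b x = ε * b x - drift w c x := gen_corr hw hε c x
  have hdr : drift w c x = gen w l x := rfl
  have hmean : meanDiv w c b x = D * ∑ i : Fin d,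
      (w (x, i) * (l (x + unitE d i) - l x) * ((b x + b (x + unitE d i)) / 2) +
        w (x - unitE d i, i) * (l (x - unitE d i) - l x) * ((b (x - unitE d i) + b x) / 2)) := by
    rw [meanDiv, ← hD]
    congr 1
    rw [Finset.sum_eq_single c]
    · simp only [l]
      rw [coordFn_add, coordFn_sub, coordFn_unitE, if_pos rfl]
      ring
    · intro i _ hi
      simp only [l]
      rw [coordFn_add, coordFn_sub, coordFn_unitE, if_neg (Ne.symm hi)]
      ring
    · simp
  have hterm : ∀ i : Fin d,
      (w (x, i) * (T (x + unitE d i) - T x) +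
        w (x - unitE d i, i) * (T (x - unitE d i) - T x))
      - (2 * l x - (l x + b x - b₀) / 2) * (w (x, i) * (b (x + unitE d i) - b x) +
        w (x - unitE d i, i) * (b (x - unitE d i) - b x))
      - (2 * l x - (l x + b x - b₀) / 2) * (w (x, i) * (l (x + unitE d i) - l x) +
        w (x - unitE d i, i) * (l (x - unitE d i) - l x))
      - 2 * (w (x, i) * (l (x + unitE d i) - l x) * ((b x + b (x + unitE d i)) / 2) +
        w (x - unitE d i, i) * (l (x - unitE d i) - l x) * ((b (x - unitE d i) + b x) / 2))
      ≤ 2 := by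
    intro i
    have key : ∀ (v s t : ℝ), 0 ≤ v → v ≤ 1 → s ^ 2 ≤ 1 →
        v * (s ^ 2 + s * t - (s + t) ^ 2 / 4) ≤ 1 := by
      intro v s t h0 h1 hs
      have : s ^ 2 + s * t - (s + t) ^ 2 / 4 ≤ 1 := by nlinarith [sq_nonneg (s - t)]
      nlinarith
    have hs1 : (l (x + unitE d i) - l x) ^ 2 ≤ 1 := by
      simp only [l]
      rw [coordFn_add, coordFn_unitE]
      split_ifs <;> norm_num
    have hs2 : (l (x - unitE d i) - l x) ^ 2 ≤ 1 := by
      simp only [l]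
      rw [coordFn_sub, coordFn_unitE]
      split_ifs <;> norm_num
    have k1 := key _ _ (b (x + unitE d i) - b x) (hw (x, i)).1 (hw (x, i)).2 hs1
    have k2 := key _ _ (b (x - unitE d i) - b x) (hw (x - unitE d i, i)).1
      (hw (x - unitE d i, i)).2 hs2
    simp only [T]
    nlinarith [k1, k2]
  have hsum := Finset.sum_le_sum fun i (_ : i ∈ Finset.univ) => hterm i
  simp only [Finset.sum_const, Finset.card_univ, Fintype.card_fin, nsmul_eq_mul,
    Finset.sum_sub_distrib, ← Finset.mul_sum] at hsum
  have h3 := mul_le_mul_of_nonneg_left hsum hD0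
  have h4 : D * (d * 2) ≤ 1 := by
    rw [hD, mul_comm (d : ℝ)]
    exact inv_mul_le_one
  have h5 : gen w T x - (2 * l x - (l x + b x - b₀) / 2) * gen w b x
      - (2 * l x - (l x + b x - b₀) / 2) * gen w l x - 2 * meanDiv w c b x ≤ 1 := by
    rw [hmean]
    simp only [gen, ← hD]
    linarith
  rw [hLb, hdr] at h5
  have h6 : ε * l x ^ 2 / 2 ≤ ε * T x - (2 * l x - (l x + b x - b₀) / 2) * (ε * b x)
      + ε * b₀ ^ 2 / 2 := by
    have : ε * T x - (2 * l x - (l x + b x - b₀) / 2) * (ε * b x)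
      + ε * b₀ ^ 2 / 2 - ε * l x ^ 2 / 2 = ε * ((l x + b₀) ^ 2 + b x ^ 2) / 4 := by
      simp only [T]; ring
    have h7 : 0 ≤ ε * ((l x + b₀) ^ 2 + b x ^ 2) / 4 := by positivity
    linarith
  linarith

lemma abs_coordFn_le (c : Fin d) (x : Site d) : |coordFn c x| ≤ ‖x‖ := by
  have := norm_le_pi_norm x c
  rwa [Int.norm_eq_abs] at this

/-- Quenched bound on the second moment at a geometric time. -/
lemma geoAvg_sq_le (hw : UnitCond w) (hε : 0 < ε) (c : Fin d) :
    ε * geoAvg w ε (fun x => coordFn c x ^ 2) 0 ≤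
      2 + ε * corr w c ε 0 ^ 2 + 4 * geoAvg w ε (meanDiv w c (corr w c ε)) 0 := by
  set b := corr w c ε with hb
  set b₀ := b 0 with hb₀
  set T : Site d → ℝ := fun x => coordFn c x ^ 2 + 2 * (coordFn c x * b x) -
    (coordFn c x + b x - b₀) ^ 2 / 4 with hT
  have hlin : ∀ x, |coordFn c x| ≤ 1 * (1 + ‖x‖) := fun x => by
    have := abs_coordFn_le c x
    linarith
  have hbb : ∀ x, |b x| ≤ ε⁻¹ * (1 + ‖x‖) := fun x => by
    have h1 := abs_corr_le hw hε c x
    have h2 : 0 < ε⁻¹ := inv_pos.2 hε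
    nlinarith [norm_nonneg x]
  have hf : ∀ x, |coordFn c x + b x - b₀| ≤ (1 + ε⁻¹ + ε⁻¹) * (1 + ‖x‖) := fun x => by
    have h0 : |b₀| ≤ ε⁻¹ := abs_corr_le hw hε c 0
    have h2 : 0 < ε⁻¹ := inv_pos.2 hε
    have h3 := abs_sub (coordFn c x + b x) b₀
    have h4 := abs_add_le (coordFn c x) (b x)
    nlinarith [norm_nonneg x, hlin x, hbb x]
  have hl2 : QuadGrowth (fun x => coordFn c x ^ 2) := by
    have := QuadGrowth.mul_of_linear hlin hlin
    convert this using 1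
    funext x; simp [sq]
  have hTg : QuadGrowth T := by
    have h1 := hl2.add (((QuadGrowth.mul_of_linear hlin hbb).smul 2).add
      ((QuadGrowth.mul_of_linear hf hf).smul (-1 / 4)))
    convert h1 using 1
    funext x
    simp only [hT, Pi.add_apply, Pi.smul_apply, Pi.mul_apply, smul_eq_mul]
    ring
  have hmg : QuadGrowth (meanDiv w c b) :=
    .of_bounded (abs_meanDiv_le hw c (abs_corr_le hw hε c))
  have hcg : QuadGrowth (d := d) (fun _ => ε * b₀ ^ 2 / 2 + 1) :=
    .of_bounded (C := |ε * b₀ ^ 2 / 2 + 1|) fun _ => le_rfl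
  have hmono := geoAvg_mono hw hε (hl2.smul (ε / 2))
    (((hTg.smul ε).add ((hTg.gen hw).smul (-1))).add (hcg.add (hmg.smul 2)))
    (fun x => by
      have h : ε * coordFn c x ^ 2 / 2 ≤ (ε * T x - gen w T x) + (ε * b₀ ^ 2 / 2 + 1) +
        2 * meanDiv w c b x := half_sq_le hw hε c b₀ x
      simp only [Pi.add_apply, Pi.smul_apply, smul_eq_mul]
      linarith) 0
  rw [geoAvg_add hw hε ((hTg.smul ε).add ((hTg.gen hw).smul (-1))) (hcg.add (hmg.smul 2)),
    geoAvg_add hw hε (hTg.smul ε) ((hTg.gen hw).smul (-1)),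
    geoAvg_add hw hε hcg (hmg.smul 2), geoAvg_smul, geoAvg_smul, geoAvg_smul, geoAvg_smul,
    geoAvg_const hε] at hmono
  simp only [Pi.add_apply, Pi.smul_apply, smul_eq_mul] at hmono
  rw [geoAvg_gen hw hε hTg] at hmono
  have hT0 : T 0 = 0 := by
    simp [hT, coordFn, hb₀]
  rw [hT0] at hmono
  linarith

end Resolvent

/-! ### Stationary fields -/

/-- The conductances truncated to `[0, 1]`. -/
def clamp {d : ℕ} (ω : Env d) : Env d := fun e => max 0 (min (ω e) 1)

lemma unitCond_clamp {d : ℕ} (ω : Env d) : UnitCond (clamp ω) := fun _ =>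
  ⟨le_max_left _ _, max_le zero_le_one (min_le_right _ _)⟩

lemma clamp_eq_self {d : ℕ} {ω : Env d} (h : UnitCond ω) : clamp ω = ω := by
  funext e
  simp [clamp, (h e).1, (h e).2]

/-- Bounded measurable random fields that are covariant under the shifts of the environment. -/
structure StatField {d : ℕ} (Φ : Env d → Site d → ℝ) : Prop where
  meas : ∀ x, Measurable fun ω => Φ ω x
  bdd : ∃ C : ℝ, ∀ ω x, |Φ ω x| ≤ C
  cov : ∀ z ω x, Φ (shiftBy d z ω) x = Φ ω (x + z)

/-- The generator acting on random fields. -/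
def genF {d : ℕ} (Φ : Env d → Site d → ℝ) : Env d → Site d → ℝ := fun ω => gen (clamp ω) (Φ ω)

/-- The geometric average acting on random fields. -/
def geoF {d : ℕ} (ε : ℝ) (Φ : Env d → Site d → ℝ) : Env d → Site d → ℝ :=
  fun ω => geoAvg (clamp ω) ε (Φ ω)

/-- The conductance of the edge above `x` in direction `i`, as a random field. -/
def condF {d : ℕ} (i : Fin d) : Env d → Site d → ℝ := fun ω x => clamp ω (x, i)

/-- The translate of a random field. -/
def transF {d : ℕ} (z : Site d) (Φ : Env d → Site d → ℝ) : Env d → Site d → ℝ :=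
  fun ω x => Φ ω (x + z)

section Fields

variable {d : ℕ} {Φ Ψ K : Env d → Site d → ℝ} {ε : ℝ}

lemma StatField.const (c : ℝ) : StatField (d := d) fun _ _ => c :=
  ⟨fun _ => measurable_const, ⟨|c|, fun _ _ => le_rfl⟩, fun _ _ _ => rfl⟩

lemma StatField.cond (i : Fin d) : StatField (condF i) := by
  refine ⟨fun x => ?_, ⟨1, fun ω x => ?_⟩, fun z ω x => rfl⟩
  · exact measurable_const.max ((measurable_pi_apply _).min measurable_const)
  · have := unitCond_clamp ω (x, i)
    rw [abs_le]
    exact ⟨by unfold condF; linarith, this.2⟩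

lemma StatField.trans (hΦ : StatField Φ) (z : Site d) : StatField (transF z Φ) := by
  refine ⟨fun x => hΦ.meas _, hΦ.bdd.imp fun C h ω x => h ω _, fun y ω x => ?_⟩
  rw [transF, hΦ.cov, transF, add_right_comm]

lemma StatField.add (hΦ : StatField Φ) (hΨ : StatField Ψ) : StatField (Φ + Ψ) := by
  obtain ⟨A, hA⟩ := hΦ.bdd
  obtain ⟨B, hB⟩ := hΨ.bdd
  refine ⟨fun x => (hΦ.meas x).add (hΨ.meas x), ⟨A + B, fun ω x => ?_⟩, fun y ω x => ?_⟩
  · exact (abs_add_le _ _).trans (add_le_add (hA ω x) (hB ω x))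
  · simp only [Pi.add_apply, hΦ.cov, hΨ.cov]

lemma StatField.mul (hΦ : StatField Φ) (hΨ : StatField Ψ) : StatField (Φ * Ψ) := by
  obtain ⟨A, hA⟩ := hΦ.bdd
  obtain ⟨B, hB⟩ := hΨ.bdd
  refine ⟨fun x => (hΦ.meas x).mul (hΨ.meas x), ⟨A * B, fun ω x => ?_⟩, fun y ω x => ?_⟩
  · simp only [Pi.mul_apply, abs_mul]
    exact mul_le_mul (hA ω x) (hB ω x) (abs_nonneg _) ((abs_nonneg _).trans (hA ω x))
  · simp only [Pi.mul_apply, hΦ.cov, hΨ.cov]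

lemma StatField.smul (hΦ : StatField Φ) (c : ℝ) : StatField (c • Φ) :=
  (StatField.const c).mul hΦ

lemma StatField.sub (hΦ : StatField Φ) (hΨ : StatField Ψ) : StatField (Φ - Ψ) := by
  have := hΦ.add (hΨ.smul (-1))
  rwa [neg_smul, one_smul, ← sub_eq_add_neg] at this

lemma StatField.sum {ι : Type*} (s : Finset ι) {f : ι → Env d → Site d → ℝ}
    (h : ∀ i, StatField (f i)) : StatField (∑ i ∈ s, f i) := by
  induction s using Finset.induction_on with
  | empty => exact StatField.const 0
  | insert i s hi ih =>
    rw [Finset.sum_insert hi]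
    exact (h i).add ih

lemma genF_eq (Φ : Env d → Site d → ℝ) :
    genF Φ = (2 * (d : ℝ))⁻¹ • ∑ i : Fin d, (condF i * (transF (unitE d i) Φ - Φ) -
      transF (-unitE d i) (condF i * (transF (unitE d i) Φ - Φ))) := by
  funext ω x
  simp only [genF, gen, Pi.smul_apply, Finset.sum_apply, smul_eq_mul, Pi.sub_apply, Pi.mul_apply,
    transF, condF, ← sub_eq_add_neg, sub_add_cancel]
  congr 1
  exact Finset.sum_congr rfl fun i _ => by ring

lemma StatField.grad (hΦ : StatField Φ) (i : Fin d) :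
    StatField (transF (unitE d i) Φ - Φ) := (hΦ.trans _).sub hΦ

lemma StatField.gen (hΦ : StatField Φ) : StatField (genF Φ) := by
  rw [genF_eq]
  refine (StatField.sum _ fun i => ?_).smul _
  have h := (StatField.cond i).mul (hΦ.grad i)
  exact h.sub (h.trans _)

lemma StatField.iterate_step (hΦ : StatField Φ) (j : ℕ) :
    StatField fun ω => (step (clamp ω))^[j] (Φ ω) := by
  induction j with
  | zero => exact hΦ
  | succ j ih =>
    simp only [Function.iterate_succ', Function.comp_apply]
    exact ih.add ih.gen

lemma StatField.geo (hΦ : StatField Φ) (hε : 0 < ε) : StatField (geoF ε Φ) := by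
  obtain ⟨C, hC⟩ := hΦ.bdd
  refine ⟨fun x => ?_, ⟨C, fun ω x => abs_geoAvg_le (unitCond_clamp ω) hε (hC ω) x⟩,
    fun z ω x => ?_⟩
  · have hs := fun ω => (summable_geoAvg (unitCond_clamp ω) hε (.of_bounded (hC ω)) x).hasSum
    refine measurable_of_tendsto_metrizable (f := fun n ω => ∑ j ∈ Finset.range n,
      ε / (1 + ε) * (1 / (1 + ε)) ^ j * ((step (clamp ω))^[j] (Φ ω)) x) (fun n => ?_)
      (tendsto_pi_nhds.2 fun ω => (hs ω).tendsto_sum_nat)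
    exact Finset.measurable_sum _ fun j _ => ((hΦ.iterate_step j).meas x).const_mul _
  · exact tsum_congr fun j => by rw [(hΦ.iterate_step j).cov]

/-- The drift of the clamped walk as a random field. -/
def driftF (c : Fin d) : Env d → Site d → ℝ := fun ω => drift (clamp ω) c

lemma StatField.drift (c : Fin d) : StatField (driftF c) := by
  have : driftF c =
      (2 * (d : ℝ))⁻¹ • (condF c - transF (-unitE d c) (condF c)) := by
    funext ω x
    simp only [driftF, drift_eq, Pi.smul_apply, Pi.sub_apply, smul_eq_mul, transF, condF,
      ← sub_eq_add_neg]
  rw [this]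
  exact ((StatField.cond c).sub ((StatField.cond c).trans _)).smul _

/-- The approximate corrector as a random field. -/
def corrF (c : Fin d) (ε : ℝ) : Env d → Site d → ℝ := fun ω => corr (clamp ω) c ε

lemma StatField.corr (c : Fin d) (hε : 0 < ε) : StatField (corrF c ε) :=
  ((StatField.drift c).geo hε).smul ε⁻¹

lemma genF_corrF (c : Fin d) (hε : 0 < ε) :
    genF (corrF c ε) = ε • corrF c ε - driftF c := by
  funext ω x
  exact gen_corr (unitCond_clamp ω) hε c x

lemma genF_geoF (hΦ : StatField Φ) (hε : 0 < ε) :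
    genF (geoF ε Φ) = ε • geoF ε Φ - ε • Φ := by
  obtain ⟨C, hC⟩ := hΦ.bdd
  funext ω x
  refine (gen_geoAvg (unitCond_clamp ω) hε (.of_bounded (hC ω)) x).trans ?_
  simp only [Pi.sub_apply, Pi.smul_apply, smul_eq_mul, geoF]
  ring

lemma genF_sub (Φ Ψ : Env d → Site d → ℝ) : genF (Φ - Ψ) = genF Φ - genF Ψ := by
  funext ω
  have h : (Φ - Ψ) ω = Φ ω + (-1 : ℝ) • Ψ ω := by
    rw [Pi.sub_apply, neg_smul, one_smul, ← sub_eq_add_neg]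
  rw [genF, h, gen_add, gen_smul, neg_smul, one_smul, ← sub_eq_add_neg]
  rfl

/-- The `L²` inner product of random fields at the origin. -/
def ip (P : Measure (Env d)) (Φ Ψ : Env d → Site d → ℝ) : ℝ := ∫ ω, Φ ω 0 * Ψ ω 0 ∂P

variable {P : Measure (Env d)}

lemma ip_comm (Φ Ψ : Env d → Site d → ℝ) : ip P Φ Ψ = ip P Ψ Φ := by
  simp only [ip, mul_comm]

lemma ip_smul_left (a : ℝ) (Φ Ψ : Env d → Site d → ℝ) : ip P (a • Φ) Ψ = a * ip P Φ Ψ := by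
  simp only [ip, Pi.smul_apply, smul_eq_mul, mul_assoc, integral_const_mul]

lemma ip_smul_right (a : ℝ) (Φ Ψ : Env d → Site d → ℝ) : ip P Φ (a • Ψ) = a * ip P Φ Ψ := by
  rw [ip_comm, ip_smul_left, ip_comm]

lemma ip_self_nonneg (Φ : Env d → Site d → ℝ) : 0 ≤ ip P Φ Φ :=
  integral_nonneg fun _ => mul_self_nonneg _

lemma measurable_shiftBy (z : Site d) : Measurable (shiftBy d z) :=
  measurable_pi_lambda _ fun _ => measurable_pi_apply _

lemma StatField.integral_eq (hP : ∀ z, P.map (shiftBy d z) = P) (hΦ : StatField Φ) (x : Site d) :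
    ∫ ω, Φ ω x ∂P = ∫ ω, Φ ω 0 ∂P := by
  conv_rhs => rw [← hP x]
  rw [integral_map (measurable_shiftBy x).aemeasurable (hΦ.meas 0).aestronglyMeasurable]
  simp only [hΦ.cov, zero_add]

lemma ip_condF_nonneg (Φ : Env d → Site d → ℝ) (i : Fin d) : 0 ≤ ip P Φ (condF i * Φ) := by
  refine integral_nonneg fun ω => ?_
  have := (unitCond_clamp ω (0, i)).1
  have h : Φ ω 0 * (condF i * Φ) ω 0 = clamp ω (0, i) * (Φ ω 0 * Φ ω 0) := by
    simp only [Pi.mul_apply, condF]; ring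
  simp only [h]
  exact mul_nonneg this (mul_self_nonneg _)

variable [IsProbabilityMeasure P]

lemma StatField.integrable (hΦ : StatField Φ) (x : Site d) : Integrable (fun ω => Φ ω x) P := by
  obtain ⟨C, hC⟩ := hΦ.bdd
  exact Integrable.of_bound (hΦ.meas x).aestronglyMeasurable C (ae_of_all _ fun ω => hC ω x)

lemma StatField.integrable_mul (hΦ : StatField Φ) (hΨ : StatField Ψ) :
    Integrable (fun ω => Φ ω 0 * Ψ ω 0) P := (hΦ.mul hΨ).integrable 0

lemma ip_sub_left (hΦ : StatField Φ) (hΨ : StatField Ψ) (hK : StatField K) :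
    ip P (Φ - Ψ) K = ip P Φ K - ip P Ψ K := by
  unfold ip
  rw [← integral_sub (hΦ.integrable_mul hK) (hΨ.integrable_mul hK)]
  simp only [Pi.sub_apply, sub_mul]

lemma ip_sub_right (hΦ : StatField Φ) (hΨ : StatField Ψ) (hK : StatField K) :
    ip P K (Φ - Ψ) = ip P K Φ - ip P K Ψ := by
  rw [ip_comm, ip_sub_left hΦ hΨ hK, ip_comm, ip_comm Ψ]

lemma ip_sum_right {ι : Type*} (s : Finset ι) {f : ι → Env d → Site d → ℝ}
    (h : ∀ i, StatField (f i)) (hΦ : StatField Φ) :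
    ip P Φ (∑ i ∈ s, f i) = ∑ i ∈ s, ip P Φ (f i) := by
  unfold ip
  rw [← integral_finsetSum _ fun i _ => hΦ.integrable_mul (h i)]
  simp only [Finset.sum_apply, Finset.mul_sum]

/-- Summation by parts for stationary fields. -/
lemma ip_sub_trans (hP : ∀ z, P.map (shiftBy d z) = P) (hΦ : StatField Φ) (hK : StatField K)
    (e : Site d) : ip P Φ (K - transF (-e) K) = -ip P (transF e Φ - Φ) K := by
  rw [ip_sub_right hK (hK.trans _) hΦ, ip_sub_left (hΦ.trans _) hΦ hK]
  have h := ((hΦ.trans e).mul hK).integral_eq hP (-e)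
  simp only [transF, Pi.mul_apply, neg_add_cancel] at h
  simp only [ip, transF, zero_add] at h ⊢
  rw [h]
  ring

lemma ip_genF (hP : ∀ z, P.map (shiftBy d z) = P) (hΦ : StatField Φ) (hΨ : StatField Ψ) :
    ip P Φ (genF Ψ) = -((2 * (d : ℝ))⁻¹ * ∑ i : Fin d,
      ip P (transF (unitE d i) Φ - Φ) (condF i * (transF (unitE d i) Ψ - Ψ))) := by
  have h := fun i => (StatField.cond i).mul (hΨ.grad i)
  rw [genF_eq, ip_smul_right, ip_sum_right _ (fun i => (h i).sub ((h i).trans _)) hΦ,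
    ← mul_neg, ← Finset.sum_neg_distrib]
  congr 1
  exact Finset.sum_congr rfl fun i _ => ip_sub_trans hP hΦ (h i) _

lemma ip_genF_comm (hP : ∀ z, P.map (shiftBy d z) = P) (hΦ : StatField Φ) (hΨ : StatField Ψ) :
    ip P Φ (genF Ψ) = ip P Ψ (genF Φ) := by
  rw [ip_genF hP hΦ hΨ, ip_genF hP hΨ hΦ]
  congr 2
  refine Finset.sum_congr rfl fun i _ => ?_
  simp only [ip, Pi.mul_apply]
  congr 1
  funext ω
  ring

lemma ip_genF_self_nonpos (hP : ∀ z, P.map (shiftBy d z) = P) (hΦ : StatField Φ) :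
    ip P Φ (genF Φ) ≤ 0 := by
  rw [ip_genF hP hΦ hΦ, neg_nonpos]
  exact mul_nonneg (by positivity) (Finset.sum_nonneg fun i _ => ip_condF_nonneg _ i)

/-- Divergences of flows carried by the conductances are controlled by the Dirichlet form. -/
lemma ip_div_le (hP : ∀ z, P.map (shiftBy d z) = P) (hΦ : StatField Φ) (hK : StatField K)
    (c : Fin d) (s : ℝ) :
    2 * s * ip P Φ ((2 * (d : ℝ))⁻¹ • (condF c * K - transF (-unitE d c) (condF c * K))) ≤
      s ^ 2 * ip P K K - ip P Φ (genF Φ) := by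
  have hc := StatField.cond c
  rw [ip_smul_right, ip_sub_trans hP hΦ (hc.mul hK), ip_genF hP hΦ hΦ]
  set D : ℝ := (2 * (d : ℝ))⁻¹ with hD
  set g := transF (unitE d c) Φ - Φ with hg
  have hgs : StatField g := hΦ.grad c
  have hD0 : 0 ≤ D := by positivity
  have hD1 : D ≤ 1 := by
    refine inv_le_one_of_one_le₀ ?_
    have : (1 : ℝ) ≤ d := by exact_mod_cast c.pos
    linarith
  have h1 : ip P g (condF c * g) ≤ ∑ i : Fin d,
      ip P (transF (unitE d i) Φ - Φ) (condF i * (transF (unitE d i) Φ - Φ)) :=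
    Finset.single_le_sum (f := fun i => ip P (transF (unitE d i) Φ - Φ)
      (condF i * (transF (unitE d i) Φ - Φ))) (fun i _ => ip_condF_nonneg _ i) (Finset.mem_univ c)
  have h2 : -(2 * s) * ip P g (condF c * K) ≤ s ^ 2 * ip P K K + ip P g (condF c * g) := by
    unfold ip
    rw [← integral_const_mul, ← integral_const_mul, ← integral_add
      ((hK.integrable_mul hK).const_mul _) (hgs.integrable_mul (hc.mul hgs))]
    refine integral_mono ((hgs.integrable_mul (hc.mul hK)).const_mul _)
      (((hK.integrable_mul hK).const_mul _).add (hgs.integrable_mul (hc.mul hgs)))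
      fun ω => ?_
    have hw := unitCond_clamp ω (0, c)
    simp only [Pi.mul_apply, condF]
    nlinarith [mul_nonneg hw.1 (sq_nonneg (s * K ω 0 + g ω 0)),
      mul_nonneg (sub_nonneg.2 hw.2) (sq_nonneg (s * K ω 0))]
  have h3 := mul_le_mul_of_nonneg_left (h2.trans (add_le_add_right h1 _)) hD0
  have h4 : D * (s ^ 2 * ip P K K) ≤ s ^ 2 * ip P K K :=
    mul_le_of_le_one_left (mul_nonneg (sq_nonneg s) (ip_self_nonneg K)) hD1
  linarith

/-! ### Annealed estimates for the corrector -/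

lemma ip_geoF_comm (hP : ∀ z, P.map (shiftBy d z) = P) (hΦ : StatField Φ) (hΨ : StatField Ψ)
    (hε : 0 < ε) : ip P (geoF ε Φ) Ψ = ip P (geoF ε Ψ) Φ := by
  have h := ip_genF_comm hP (hΦ.geo hε) (hΨ.geo hε)
  rw [genF_geoF hΦ hε, genF_geoF hΨ hε, ip_sub_right ((hΨ.geo hε).smul _) (hΨ.smul _) (hΦ.geo hε),
    ip_sub_right ((hΦ.geo hε).smul _) (hΦ.smul _) (hΨ.geo hε)] at h
  simp only [ip_smul_right] at h
  rw [ip_comm (geoF ε Φ) (geoF ε Ψ)] at h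
  have := mul_left_cancel₀ hε.ne' (sub_right_injective h)
  exact this

/-- The divergence field of the edge means of the corrector. -/
def meanDivF (c : Fin d) (ε : ℝ) : Env d → Site d → ℝ :=
  fun ω => meanDiv (clamp ω) c (corrF c ε ω)

lemma ip_driftF_corrF (hP : ∀ z, P.map (shiftBy d z) = P) (c : Fin d) (hε : 0 < ε) :
    0 ≤ ip P (corrF c ε) (driftF c) ∧ ip P (corrF c ε) (driftF c) ≤ 1 := by
  have hb := StatField.corr c hε
  have hg := genF_corrF c hε
  have h1 := ip_genF_self_nonpos hP hb
  have hbb := ip_self_nonneg (P := P) (corrF c ε)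
  have h2 := ip_div_le hP hb (StatField.const 1) c 1
  have h3 : (2 * (d : ℝ))⁻¹ • (condF c * (fun _ _ => 1) -
      transF (-unitE d c) (condF c * fun _ _ => 1)) = driftF c := by
    funext ω x
    simp only [driftF, drift_eq, Pi.smul_apply, Pi.sub_apply, smul_eq_mul, transF, condF,
      ← sub_eq_add_neg, Pi.mul_apply, mul_one]
  have h4 : ip P (fun _ _ => (1 : ℝ)) (fun _ _ => (1 : ℝ)) = 1 := by simp [ip]
  rw [h3, h4] at h2
  rw [hg, ip_sub_right (hb.smul ε) (StatField.drift c) hb, ip_smul_right] at h1 h2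
  constructor <;> nlinarith

lemma ip_corrF_diff (hP : ∀ z, P.map (shiftBy d z) = P) (c : Fin d) {δ : ℝ} (hδ : 0 < δ)
    (h : δ ≤ ε) : (ε - δ) * ip P (corrF c ε) (corrF c ε) ≤
      ip P (corrF c δ) (driftF c) - ip P (corrF c ε) (driftF c) := by
  have hε := hδ.trans_le h
  have hb := StatField.corr c hε
  have hb' := StatField.corr c hδ
  have hβ := StatField.drift c
  have hg := genF_corrF c hε
  have hg' := genF_corrF c hδ
  have h1 := ip_genF_comm hP hb hb'
  have h2 := ip_genF_self_nonpos hP (hb'.sub hb)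
  have h3 := ip_self_nonneg (P := P) (corrF c δ - corrF c ε)
  rw [hg, hg', ip_sub_right (hb'.smul δ) hβ hb, ip_sub_right (hb.smul ε) hβ hb', ip_smul_right,
    ip_smul_right, ip_comm (corrF c δ) (corrF c ε)] at h1
  rw [genF_sub, hg, hg', sub_sub_sub_cancel_right,
    ip_sub_right (hb'.smul δ) (hb.smul ε) (hb'.sub hb), ip_smul_right, ip_smul_right,
    ip_sub_left hb' hb hb', ip_sub_left hb' hb hb, ip_comm (corrF c δ) (corrF c ε)] at h2
  rw [ip_sub_right hb' hb (hb'.sub hb), ip_sub_left hb' hb hb', ip_sub_left hb' hb hb,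
    ip_comm (corrF c δ) (corrF c ε)] at h3
  have h4 : 0 ≤ (ε - δ) * (ip P (corrF c ε) (corrF c δ) - ip P (corrF c ε) (corrF c ε)) := by
    nlinarith
  linarith

lemma meanDivF_eq (c : Fin d) (ε : ℝ) : meanDivF c ε = (2 * (d : ℝ))⁻¹ •
    (condF c * ((2 : ℝ)⁻¹ • (corrF c ε + transF (unitE d c) (corrF c ε))) -
      transF (-unitE d c)
        (condF c * ((2 : ℝ)⁻¹ • (corrF c ε + transF (unitE d c) (corrF c ε))))) := by
  funext ω x
  simp only [meanDivF, meanDiv, Pi.smul_apply, Pi.sub_apply, smul_eq_mul, transF, condF,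
    ← sub_eq_add_neg, Pi.mul_apply, Pi.add_apply, sub_add_cancel]
  ring

lemma StatField.meanDiv (c : Fin d) (hε : 0 < ε) : StatField (meanDivF c ε) := by
  have hb := StatField.corr c hε
  have h := (StatField.cond c).mul ((hb.add (hb.trans (unitE d c))).smul 2⁻¹)
  rw [meanDivF_eq]
  exact (h.sub (h.trans _)).smul _

lemma ip_mean_le (hP : ∀ z, P.map (shiftBy d z) = P) (hΦ : StatField Φ) (z : Site d) :
    ip P ((2 : ℝ)⁻¹ • (Φ + transF z Φ)) ((2 : ℝ)⁻¹ • (Φ + transF z Φ)) ≤ ip P Φ Φ := by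
  have h : ∫ ω, Φ ω z * Φ ω z ∂P = ip P Φ Φ := (hΦ.mul hΦ).integral_eq hP z
  have hz : Integrable (fun ω => Φ ω z * Φ ω z) P := (hΦ.mul hΦ).integrable z
  have hm := (hΦ.add (hΦ.trans z)).smul 2⁻¹
  have h2 : ip P Φ Φ = ∫ ω, 2⁻¹ * (Φ ω 0 * Φ ω 0) + 2⁻¹ * (Φ ω z * Φ ω z) ∂P := by
    rw [integral_add ((hΦ.integrable_mul hΦ).const_mul _) (hz.const_mul _), integral_const_mul,
      integral_const_mul, h]
    unfold ip
    ring
  rw [h2]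
  refine integral_mono (hm.integrable_mul hm)
    (((hΦ.integrable_mul hΦ).const_mul _).add (hz.const_mul _)) fun ω => ?_
  simp only [Pi.smul_apply, Pi.add_apply, smul_eq_mul, transF, zero_add]
  nlinarith [sq_nonneg (Φ ω 0 - Φ ω z)]

lemma ip_geoF_meanDivF_le (hP : ∀ z, P.map (shiftBy d z) = P) (c : Fin d) (hε : 0 < ε) :
    ip P (geoF ε (meanDivF c ε)) (geoF ε (meanDivF c ε)) ≤
      ε * ip P (corrF c ε) (corrF c ε) := by
  have hb := StatField.corr c hε
  have hh := StatField.meanDiv c hε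
  set g := geoF ε (meanDivF c ε) with hgdef
  have hg : StatField g := hh.geo hε
  have hG : StatField (geoF ε g) := hg.geo hε
  have h1 : ip P g g = ip P (geoF ε g) (meanDivF c ε) := ip_geoF_comm hP hh hg hε
  have h2 := ip_div_le hP hG ((hb.add (hb.trans (unitE d c))).smul 2⁻¹) c ε
  rw [← meanDivF_eq, ← h1, genF_geoF hg hε, ip_sub_right (hG.smul ε) (hg.smul ε) hG,
    ip_smul_right ε _ (geoF ε g), ip_smul_right ε _ g] at h2
  have h3 := ip_self_nonneg (P := P) (geoF ε g - (2 : ℝ)⁻¹ • g)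
  rw [ip_sub_right hG (hg.smul _) (hG.sub (hg.smul _)), ip_sub_left hG (hg.smul _) hG,
    ip_smul_right, ip_sub_left hG (hg.smul _) hg, ip_smul_left, ip_smul_left,
    ip_comm g (geoF ε g)] at h3
  have h4 := mul_le_mul_of_nonneg_left (ip_mean_le hP hb (unitE d c)) (sq_nonneg ε)
  have h5 := ip_self_nonneg (P := P) g
  have h6 := mul_nonneg hε.le h3
  refine le_of_mul_le_mul_left ?_ hε
  nlinarith [mul_nonneg hε.le h5]

/-- The quenched second moment at geometric times of mean `2 ^ k` is `O(2 ^ k)`. -/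
lemma ae_exists_geoAvg_sq_le (hP : ∀ z, P.map (shiftBy d z) = P) (c : Fin d) :
    ∀ᵐ ω ∂P, ∃ M : ℝ, ∀ k : ℕ,
      (1 / 2 : ℝ) ^ k * geoAvg (clamp ω) ((1 / 2) ^ k) (fun x => coordFn c x ^ 2) 0 ≤ M := by
  set e : ℕ → ℝ := fun k => (1 / 2 : ℝ) ^ k with he
  have he0 : ∀ k, 0 < e k := fun k => by positivity
  set g : ℕ → Env d → Site d → ℝ := fun k => geoF (e k) (meanDivF c (e k)) with hg
  have hgs : ∀ k, StatField (g k) := fun k => (StatField.meanDiv c (he0 k)).geo (he0 k)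
  have hbs : ∀ k, StatField (corrF c (e k)) := fun k => StatField.corr c (he0 k)
  set Y : ℕ → Env d → ℝ := fun k ω =>
    e k * (corrF c (e k) ω 0 * corrF c (e k) ω 0) + g k ω 0 * g k ω 0 with hY
  have hY0 : ∀ k ω, 0 ≤ Y k ω := fun k ω =>
    add_nonneg (mul_nonneg (he0 k).le (mul_self_nonneg _)) (mul_self_nonneg _)
  have hYi : ∀ k, Integrable (Y k) P := fun k =>
    (((hbs k).integrable_mul (hbs k)).const_mul _).add ((hgs k).integrable_mul (hgs k))
  have hYm : ∀ k, Measurable (Y k) := fun k =>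
    (((hbs k).mul (hbs k)).meas 0 |>.const_mul _).add (((hgs k).mul (hgs k)).meas 0)
  have hYint : ∀ k, ∫ ω, Y k ω ∂P ≤
      4 * (ip P (corrF c (e (k + 1))) (driftF c) - ip P (corrF c (e k)) (driftF c)) := by
    intro k
    have h1 : ∫ ω, Y k ω ∂P = e k * ip P (corrF c (e k)) (corrF c (e k)) + ip P (g k) (g k) := by
      simp only [hY]
      rw [integral_add (((hbs k).integrable_mul (hbs k)).const_mul _)
        ((hgs k).integrable_mul (hgs k)), integral_const_mul]
      rfl
    have h2 := ip_geoF_meanDivF_le hP c (he0 k)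
    have hek : e (k + 1) = e k / 2 := by simp only [he, pow_succ]; ring
    have h3 := ip_corrF_diff hP c (he0 (k + 1)) (ε := e k) (by rw [hek]; linarith [he0 k])
    rw [hek] at h3 ⊢
    rw [h1]
    linarith
  have hsum : ∀ n, ∑ k ∈ Finset.range n, ∫ ω, Y k ω ∂P ≤ 4 := by
    intro n
    refine (Finset.sum_le_sum fun k _ => hYint k).trans ?_
    rw [← Finset.mul_sum, Finset.sum_range_sub (fun k => ip P (corrF c (e k)) (driftF c))]
    linarith [(ip_driftF_corrF hP c (he0 n)).2, (ip_driftF_corrF hP c (he0 0)).1]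
  have hlin : ∫⁻ ω, ∑' k, ENNReal.ofReal (Y k ω) ∂P ≤ 4 := by
    rw [lintegral_tsum fun k => (hYm k).ennreal_ofReal.aemeasurable]
    refine ENNReal.tsum_le_of_sum_range_le fun n => ?_
    have : ∀ k, ∫⁻ ω, ENNReal.ofReal (Y k ω) ∂P = ENNReal.ofReal (∫ ω, Y k ω ∂P) := fun k =>
      (ofReal_integral_eq_lintegral_ofReal (hYi k) (ae_of_all _ (hY0 k))).symm
    simp only [this]
    rw [← ENNReal.ofReal_sum_of_nonneg fun k _ => integral_nonneg (hY0 k)]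
    refine ENNReal.ofReal_le_of_le_toReal ?_
    simpa using hsum n
  have hae := ae_lt_top (Measurable.tsum fun k => (hYm k).ennreal_ofReal)
    (hlin.trans_lt (by norm_num)).ne
  filter_upwards [hae] with ω hω
  refine ⟨6 + 5 * (∑' k, ENNReal.ofReal (Y k ω)).toReal, fun k => ?_⟩
  have h1 : Y k ω ≤ (∑' k, ENNReal.ofReal (Y k ω)).toReal := by
    have := ENNReal.toReal_mono hω.ne (ENNReal.le_tsum (f := fun k => ENNReal.ofReal (Y k ω)) k)
    rwa [ENNReal.toReal_ofReal (hY0 k ω)] at this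
  have h2 : e k * geoAvg (clamp ω) (e k) (fun x => coordFn c x ^ 2) 0 ≤
      2 + e k * corrF c (e k) ω 0 ^ 2 + 4 * g k ω 0 :=
    geoAvg_sq_le (unitCond_clamp ω) (he0 k) c
  have h3 : 0 ≤ e k * (corrF c (e k) ω 0 * corrF c (e k) ω 0) :=
    mul_nonneg (he0 k).le (mul_self_nonneg _)
  refine h2.trans ?_
  have h4 : Y k ω = e k * (corrF c (e k) ω 0 * corrF c (e k) ω 0) + g k ω 0 * g k ω 0 := rfl
  nlinarith [sq_nonneg (g k ω 0 - 2)]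

end Fields

/-! ### Symmetry of the transition operator and the return probability -/

section HeatKernel

variable {d : ℕ} {w : Env d} {F G : Site d → ℝ} {ε : ℝ}

/-- The flow `w ∇F` through the edges of direction `i`. -/
def flow (w : Env d) (F : Site d → ℝ) (i : Fin d) (x : Site d) : ℝ :=
  w (x, i) * (F (x + unitE d i) - F x)

lemma gen_eq_flow (F : Site d → ℝ) (x : Site d) :
    gen w F x = (2 * (d : ℝ))⁻¹ * ∑ i, (flow w F i x - flow w F i (x - unitE d i)) := by
  unfold gen flow
  congr 1
  refine Finset.sum_congr rfl fun i _ => ?_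
  rw [sub_add_cancel]
  ring

lemma summable_of_support_finite (hF : F.support.Finite) : Summable F :=
  summable_of_hasFiniteSupport hF

lemma finite_support_translate (hF : F.support.Finite) (z : Site d) :
    (Function.support fun x => F (x + z)).Finite :=
  hF.preimage (add_left_injective z).injOn

lemma finite_support_mul_left (hF : F.support.Finite) (G : Site d → ℝ) :
    (Function.support fun x => G x * F x).Finite :=
  hF.subset fun x hx h => hx (by simp [Function.notMem_support.1 (by simpa using h)])

lemma finite_support_flow (hF : F.support.Finite) (i : Fin d) :
    (flow w F i).support.Finite :=
  finite_support_mul_left (((finite_support_translate hF _).union hF).subset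
    (Function.support_sub _ _)) fun x => w (x, i)

lemma finite_support_sub_translate (hF : F.support.Finite) (z : Site d) :
    (Function.support fun x => F x - F (x - z)).Finite := by
  simp only [sub_eq_add_neg _ z]
  exact (hF.union (finite_support_translate hF _)).subset (Function.support_sub _ _)

lemma tsum_translate (F : Site d → ℝ) (z : Site d) : ∑' x, F (x + z) = ∑' x, F x :=
  (Equiv.addRight z).tsum_eq F

lemma tsum_mul_gen (F : Site d → ℝ) (hG : G.support.Finite) :
    ∑' x, F x * gen w G x = -((2 * (d : ℝ))⁻¹ * ∑ i,
      ∑' x, w (x, i) * ((F (x + unitE d i) - F x) * (G (x + unitE d i) - G x))) := by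
  have hJ := fun i => finite_support_flow (w := w) hG i
  have hs := fun i => summable_of_support_finite
    (finite_support_mul_left (finite_support_sub_translate (hJ i) (unitE d i)) F)
  have h1 : ∀ x, F x * gen w G x = (2 * (d : ℝ))⁻¹ *
      ∑ i, F x * (flow w G i x - flow w G i (x - unitE d i)) := fun x => by
    rw [gen_eq_flow, ← Finset.mul_sum]
    ring
  simp only [h1]
  rw [tsum_mul_left, Summable.tsum_finsetSum fun i _ => hs i, ← mul_neg, ← Finset.sum_neg_distrib]
  congr 1
  refine Finset.sum_congr rfl fun i _ => ?_
  have hs1 := summable_of_support_finite (finite_support_mul_left (hJ i) F)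
  have hs2 := summable_of_support_finite
    (finite_support_mul_left (finite_support_translate (hJ i) (-unitE d i)) F)
  have hs3 := summable_of_support_finite
    (finite_support_mul_left (hJ i) fun x => F (x + unitE d i))
  have h2 : ∑' x, F x * flow w G i (x + -unitE d i) = ∑' x, F (x + unitE d i) * flow w G i x := by
    rw [← tsum_translate _ (unitE d i)]
    simp only [add_neg_cancel_right]
  simp only [mul_sub, sub_eq_add_neg _ (unitE d i)]
  rw [hs1.tsum_sub hs2, h2, ← hs1.tsum_sub hs3, ← tsum_neg]
  refine tsum_congr fun x => ?_
  unfold flow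
  ring

lemma finite_support_gen (hF : F.support.Finite) : (gen w F).support.Finite := by
  have : gen w F = fun x => (2 * (d : ℝ))⁻¹ *
      ∑ i, (flow w F i x - flow w F i (x - unitE d i)) := funext (gen_eq_flow F)
  rw [this]
  refine finite_support_mul_left ?_ fun _ => (2 * (d : ℝ))⁻¹
  refine (Set.finite_iUnion fun i => finite_support_sub_translate
    (finite_support_flow (w := w) hF i) (unitE d i)).subset fun x hx => ?_
  obtain ⟨i, -, hi⟩ := Finset.exists_ne_zero_of_sum_ne_zero hx
  exact Set.mem_iUnion.2 ⟨i, hi⟩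

lemma finite_support_step (hF : F.support.Finite) : (step w F).support.Finite :=
  (hF.union (finite_support_gen hF)).subset (Function.support_add _ _)

lemma finite_support_iterate_step (hF : F.support.Finite) (j : ℕ) :
    ((step w)^[j] F).support.Finite := by
  induction j with
  | zero => exact hF
  | succ j ih =>
    rw [Function.iterate_succ_apply']
    exact finite_support_step ih

lemma tsum_mul_step (hF : F.support.Finite) (hG : G.support.Finite) :
    ∑' x, F x * step w G x = ∑' x, step w F x * G x := by
  have h1 := summable_of_support_finite (finite_support_mul_left hG F)
  have h2 := summable_of_support_finite (finite_support_mul_left (finite_support_gen (w := w) hG) F)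
  have h3 := summable_of_support_finite (finite_support_mul_left (finite_support_gen (w := w) hF) G)
  simp only [step, mul_add, add_mul]
  simp only [mul_comm _ (G _)] at h1 h3 ⊢
  rw [h1.tsum_add h2, h1.tsum_add h3, tsum_mul_gen F hG, tsum_mul_gen G hF]
  simp only [mul_comm (G _ - G _)]

lemma tsum_mul_iterate_step (hF : F.support.Finite) (hG : G.support.Finite) (j : ℕ) :
    ∑' x, F x * (step w)^[j] G x = ∑' x, (step w)^[j] F x * G x := by
  induction j generalizing G with
  | zero => rfl
  | succ j ih =>
    rw [Function.iterate_succ_apply, ih (finite_support_step hG),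
      tsum_mul_step (finite_support_iterate_step hF j) hG, Function.iterate_succ_apply']

lemma sq_step_le (hw : UnitCond w) (F : Site d → ℝ) (x : Site d) :
    step w F x ^ 2 ≤ step w (fun y => F y ^ 2) x := by
  set a := step w F x with ha
  have h := step_mono (F := fun _ => 0)
    (G := (fun y => F y ^ 2) + ((-2 * a) • F + fun _ => a ^ 2)) hw (fun y => by
      simp only [Pi.add_apply, Pi.smul_apply, smul_eq_mul]
      nlinarith [sq_nonneg (F y - a)]) x
  have hc : ∀ c : ℝ, step w (fun _ => c) = fun _ => c := fun c => iterate_step_const c 1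
  rw [step_add, step_add, step_smul, hc, hc] at h
  simp only [Pi.add_apply, Pi.smul_apply, smul_eq_mul, ← ha] at h
  nlinarith

lemma tsum_step (hF : F.support.Finite) : ∑' x, step w F x = ∑' x, F x := by
  have hJ := fun i => finite_support_flow (w := w) hF i
  have h0 : ∑' x, gen w F x = 0 := by
    simp only [gen_eq_flow]
    rw [tsum_mul_left, Summable.tsum_finsetSum fun i _ => summable_of_support_finite
      (finite_support_sub_translate (hJ i) _)]
    refine mul_eq_zero_of_right _ (Finset.sum_eq_zero fun i _ => ?_)
    simp only [sub_eq_add_neg _ (unitE d i)]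
    rw [(summable_of_support_finite (hJ i)).tsum_sub
      (summable_of_support_finite (finite_support_translate (hJ i) _)), tsum_translate, sub_self]
  simp only [step]
  rw [(summable_of_support_finite hF).tsum_add
    (summable_of_support_finite (finite_support_gen hF)), h0, add_zero]

lemma tsum_sq_step_le (hw : UnitCond w) (hF : F.support.Finite) :
    ∑' x, step w F x ^ 2 ≤ ∑' x, F x ^ 2 := by
  have hsq : ∀ {G : Site d → ℝ}, G.support.Finite → (Function.support fun x => G x ^ 2).Finite :=
    fun hG => by simpa only [sq] using finite_support_mul_left hG _
  rw [← tsum_step (w := w) (hsq hF)]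
  exact (summable_of_support_finite (hsq (finite_support_step hF))).tsum_le_tsum
    (sq_step_le hw F) (summable_of_support_finite (finite_support_step (hsq hF)))

/-- The indicator function of a set of sites. -/
def ind (s : Set (Site d)) : Site d → ℝ := s.indicator fun _ => 1

lemma finite_support_ind {s : Set (Site d)} (hs : s.Finite) : (ind s).support.Finite :=
  hs.subset Set.support_indicator_subset

lemma tsum_ind_mul (y : Site d) (F : Site d → ℝ) : ∑' x, ind {y} x * F x = F y := by
  rw [tsum_eq_single y fun x hx => by simp [ind, hx]]
  simp [ind]

lemma iterate_step_ind_return (n : ℕ) :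
    (step w)^[2 * n] (ind {0}) 0 = ∑' x, (step w)^[n] (ind {0}) x ^ 2 := by
  have h0 := finite_support_ind (Set.finite_singleton (0 : Site d))
  rw [← tsum_ind_mul 0 ((step w)^[2 * n] _), two_mul, Function.iterate_add_apply,
    tsum_mul_iterate_step h0 (finite_support_iterate_step h0 n)]
  simp only [sq]

lemma return_antitone (hw : UnitCond w) :
    Antitone fun n => (step w)^[2 * n] (ind {0}) 0 := by
  refine antitone_nat_of_succ_le fun n => ?_
  rw [iterate_step_ind_return, iterate_step_ind_return, Function.iterate_succ_apply']
  exact tsum_sq_step_le hw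
    (finite_support_iterate_step (finite_support_ind (Set.finite_singleton 0)) n)

/-- The Cauchy–Schwarz lower bound for the return probability. -/
lemma sq_le_card_mul_return (B : Finset (Site d)) (j : ℕ) :
    (step w)^[j] (ind B) 0 ^ 2 ≤ B.card * (step w)^[2 * j] (ind {0}) 0 := by
  have h0 := finite_support_ind (Set.finite_singleton (0 : Site d))
  have hv := finite_support_iterate_step (w := w) h0 j
  have h1 : (step w)^[j] (ind B) 0 = ∑ x ∈ B, (step w)^[j] (ind {0}) x := by
    rw [← tsum_ind_mul 0 ((step w)^[j] _),
      tsum_mul_iterate_step h0 (finite_support_ind B.finite_toSet),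
      tsum_eq_sum (s := B) fun x hx => by simp [ind, hx]]
    exact Finset.sum_congr rfl fun x hx => by simp [ind, hx]
  rw [h1, iterate_step_ind_return]
  refine sq_sum_le_card_mul_sum_sq.trans (mul_le_mul_of_nonneg_left ?_ (Nat.cast_nonneg _))
  refine Summable.sum_le_tsum B (fun x _ => sq_nonneg _) (summable_of_support_finite ?_)
  simpa only [sq] using finite_support_mul_left hv _

lemma iterate_step_nonneg (hw : UnitCond w) (hF : ∀ x, 0 ≤ F x) (j : ℕ) (x : Site d) :
    0 ≤ (step w)^[j] F x := by
  have := iterate_step_mono (F := fun _ => 0) hw hF j x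
  rwa [iterate_step_const] at this

lemma ind_nonneg (s : Set (Site d)) (x : Site d) : 0 ≤ ind s x :=
  Set.indicator_nonneg (fun _ _ => zero_le_one) x

lemma abs_ind_le (s : Set (Site d)) (x : Site d) : |ind s x| ≤ 1 := by
  rw [abs_of_nonneg (ind_nonneg s x)]
  exact Set.indicator_le' (fun _ _ => le_rfl) (fun _ _ => zero_le_one) x

/-- The cube of radius `R`. -/
def cube (d R : ℕ) : Finset (Site d) := Finset.Icc (fun _ => -(R : ℤ)) fun _ => (R : ℤ)

lemma card_cube (d R : ℕ) : (cube d R).card = (2 * R + 1) ^ d := by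
  rw [cube, Pi.card_Icc]
  simp only [Int.card_Icc, Finset.prod_const, Finset.card_univ, Fintype.card_fin]
  congr 1
  omega

/-- A Markov inequality: at some time `j ≥ n` the walk is in the cube with probability at least
one half. -/
lemma exists_half_le (hw : UnitCond w) (hε : 0 < ε) {n R : ℕ} (hn : n * ε ≤ 1) {M : ℝ}
    (hM : ∀ c, ε * geoAvg w ε (fun x => coordFn c x ^ 2) 0 ≤ M) (hR : 6 * d * M < ε * R ^ 2) :
    ∃ j, n ≤ j ∧ 1 / 2 ≤ (step w)^[j] (ind (cube d R)) 0 := by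
  by_contra! hcon
  set H : Site d → ℝ := ind ((cube d R : Set (Site d))ᶜ) with hH
  have hHg : QuadGrowth H := .of_bounded (abs_ind_le _)
  have hH2 : ∀ j, n ≤ j → 1 / 2 ≤ (step w)^[j] H 0 := by
    intro j hj
    have h1 : ind (cube d R : Set (Site d)) + H = fun _ => 1 := by
      funext x
      exact congrFun (Set.indicator_self_add_compl _ _) x
    have h2 := congrFun (iterate_step_add (w := w) (ind (cube d R : Set (Site d))) H j) 0
    rw [h1, iterate_step_const, Pi.add_apply] at h2
    linarith [hcon j hj]
  have hlow : (1 / (1 + ε)) ^ n * (1 / 2) ≤ geoAvg w ε H 0 := by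
    have hs := summable_geoAvg hw hε hHg 0
    unfold geoAvg
    rw [← hs.sum_add_tsum_nat_add n]
    have h1 : 0 ≤ ∑ j ∈ Finset.range n, ε / (1 + ε) * (1 / (1 + ε)) ^ j * ((step w)^[j] H) 0 :=
      Finset.sum_nonneg fun j _ => mul_nonneg (by positivity)
        (iterate_step_nonneg hw (ind_nonneg _) j 0)
    have hgs : Summable fun j : ℕ => ε / (1 + ε) * (1 / (1 + ε)) ^ j :=
      (summable_geometric_of_lt_one (by positivity)
        (by rw [div_lt_one (by positivity)]; linarith)).mul_left _
    have h2 := Summable.tsum_le_tsum (f := fun j : ℕ => (1 / (1 + ε)) ^ n * (1 / 2) *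
      (ε / (1 + ε) * (1 / (1 + ε)) ^ j)) (fun j => ?_) (hgs.mul_left _)
      ((summable_nat_add_iff n).2 hs)
    · rw [tsum_mul_left, tsum_geo hε] at h2
      linarith
    · have h3 := mul_le_mul_of_nonneg_left (hH2 (j + n) (Nat.le_add_left _ _))
        (by positivity : 0 ≤ ε / (1 + ε) * (1 / (1 + ε)) ^ (j + n))
      refine le_trans (le_of_eq ?_) h3
      rw [pow_add]
      ring
  have hsix : 1 / 6 ≤ (1 / (1 + ε)) ^ n * (1 / 2) := by
    have h1 : (1 + ε) ^ n ≤ 3 := by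
      have h2 : (1 + ε) ^ n ≤ Real.exp ε ^ n := by
        gcongr
        linarith [Real.add_one_le_exp ε]
      rw [← Real.exp_nat_mul] at h2
      have h3 := Real.exp_le_exp.2 hn
      linarith [Real.exp_one_lt_d9]
    rw [div_pow, one_pow]
    have h4 : (1 / 3 : ℝ) ≤ 1 / (1 + ε) ^ n := one_div_le_one_div_of_le (by positivity) h1
    linarith
  have hlg : ∀ c : Fin d, QuadGrowth (fun x => coordFn c x ^ 2) := fun c => by
    have hlin : ∀ x, |coordFn c x| ≤ 1 * (1 + ‖x‖) := fun x => by
      linarith [abs_coordFn_le c x]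
    have := QuadGrowth.mul_of_linear hlin hlin
    convert this using 1
    funext x
    simp [sq]
  have hsumg : ∀ s : Finset (Fin d), QuadGrowth (∑ c ∈ s, fun x => coordFn c x ^ 2) ∧
      ε * geoAvg w ε (∑ c ∈ s, fun x => coordFn c x ^ 2) 0 ≤ s.card * M := by
    intro s
    induction s using Finset.induction_on with
    | empty =>
      have : (∑ c ∈ (∅ : Finset (Fin d)), fun x : Site d => coordFn c x ^ 2) = fun _ => (0 : ℝ) :=
        rfl
      rw [this, geoAvg_const hε]
      exact ⟨.of_bounded (C := 0) fun _ => by simp, by simp⟩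
    | insert c s hc ih =>
      rw [Finset.sum_insert hc, geoAvg_add hw hε (hlg c) ih.1, Finset.card_insert_of_notMem hc,
        Pi.add_apply]
      refine ⟨(hlg c).add ih.1, ?_⟩
      push_cast
      linarith [hM c, ih.2]
  obtain ⟨hg, hgM⟩ := hsumg Finset.univ
  rw [Finset.card_univ, Fintype.card_fin] at hgM
  have hdom : ∀ x, ((R : ℝ) ^ 2 • H) x ≤ (∑ c, fun x : Site d => coordFn c x ^ 2) x := by
    intro x
    rw [Finset.sum_apply, Pi.smul_apply, smul_eq_mul]
    by_cases hx : x ∈ cube d R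
    · have : H x = 0 := by simp [hH, ind, hx]
      rw [this, mul_zero]
      exact Finset.sum_nonneg fun c _ => sq_nonneg _
    · have : H x = 1 := by simp [hH, ind, hx]
      rw [this, mul_one]
      have hc : ∃ c, (R : ℤ) < |x c| := by
        by_contra! h
        refine hx (Finset.mem_Icc.2 ⟨fun c => (abs_le.1 (h c)).1, fun c => (abs_le.1 (h c)).2⟩)
      obtain ⟨c, hc⟩ := hc
      refine le_trans ?_ (Finset.single_le_sum (f := fun c => coordFn c x ^ 2)
        (fun c _ => sq_nonneg _) (Finset.mem_univ c))
      have h1 : (R : ℝ) ≤ |coordFn c x| := by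
        unfold coordFn
        exact_mod_cast hc.le
      rw [← sq_abs (coordFn c x)]
      gcongr
  have hup := geoAvg_mono hw hε (hHg.smul _) hg hdom 0
  rw [geoAvg_smul, Pi.smul_apply, smul_eq_mul] at hup
  have h1 := mul_le_mul_of_nonneg_left hup hε.le
  have h2 := mul_le_mul_of_nonneg_left (hsix.trans hlow) (by positivity : 0 ≤ ε * (R : ℝ) ^ 2)
  linarith

/-- Diffusive second moments at the dyadic geometric times imply the on-diagonal heat kernel
lower bound. -/
lemma exists_return_ge (hw : UnitCond w) {M : ℝ} (hM : ∀ (k : ℕ) (c : Fin d),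
    (1 / 2 : ℝ) ^ k * geoAvg w ((1 / 2) ^ k) (fun x => coordFn c x ^ 2) 0 ≤ M) :
    ∃ C : ℝ, 0 < C ∧ ∀ n : ℕ, 1 ≤ n →
      C / (n : ℝ) ^ ((d : ℝ) / 2) ≤ (step w)^[2 * n] (ind {0}) 0 := by
  set N : ℝ := √(12 * d * |M|) with hN
  have hN0 : 0 ≤ N := Real.sqrt_nonneg _
  refine ⟨1 / (4 * (2 * N + 5) ^ d), by positivity, fun n hn => ?_⟩
  set k := Nat.clog 2 n with hk
  have hk1 : n ≤ 2 ^ k := Nat.le_pow_clog one_lt_two n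
  have hk2 : 2 ^ k ≤ 2 * n := by
    rcases hn.eq_or_lt with h | h
    · simp [hk, ← h]
    · have hpos : 0 < k := Nat.clog_pos one_lt_two h
      have := Nat.pow_pred_clog_lt_self one_lt_two h
      rw [← hk] at this
      obtain ⟨m, hm⟩ := Nat.exists_eq_succ_of_ne_zero hpos.ne'
      rw [hm, Nat.pred_succ] at this
      rw [hm, pow_succ]
      omega
  have hk1' : (n : ℝ) ≤ 2 ^ k := by exact_mod_cast hk1
  have hk2' : (2 : ℝ) ^ k ≤ 2 * n := by exact_mod_cast hk2
  have hn1 : (1 : ℝ) ≤ √n := Real.one_le_sqrt.2 (by exact_mod_cast hn)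
  have hεk : (1 / 2 : ℝ) ^ k * 2 ^ k = 1 := by rw [← mul_pow]; norm_num
  have hε : (0 : ℝ) < (1 / 2) ^ k := by positivity
  set R : ℕ := ⌈N * √n⌉₊ + 1 with hRdef
  have hR1 : N * √n + 1 ≤ R := by
    push_cast [hRdef]
    linarith [Nat.le_ceil (N * √n)]
  have hR2 : (R : ℝ) ≤ N * √n + 2 := by
    push_cast [hRdef]
    linarith [(Nat.ceil_lt_add_one (by positivity : 0 ≤ N * √n)).le]
  have hR : 6 * d * M < (1 / 2 : ℝ) ^ k * R ^ 2 := by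
    have h1 : 12 * d * |M| * n < (R : ℝ) ^ 2 := by
      have h2 : (N * √n) ^ 2 = 12 * d * |M| * n := by
        rw [mul_pow, Real.sq_sqrt (Nat.cast_nonneg n), hN, Real.sq_sqrt (by positivity)]
      rw [← h2]
      have : 0 ≤ N * √n := by positivity
      nlinarith
    have h3 : 6 * d * M * 2 ^ k ≤ 12 * d * |M| * n := by
      have h4 : 6 * d * M ≤ 6 * d * |M| := by gcongr; exact le_abs_self M
      calc 6 * d * M * 2 ^ k ≤ 6 * d * |M| * 2 ^ k := by gcongr
        _ ≤ 6 * d * |M| * (2 * n) := by gcongr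
        _ = _ := by ring
    have h5 := mul_lt_mul_of_pos_left (h3.trans_lt h1) hε
    have h6 : (1 / 2 : ℝ) ^ k * (6 * d * M * 2 ^ k) = 6 * d * M := by
      rw [mul_comm (6 * d * M), ← mul_assoc, hεk, one_mul]
    linarith
  obtain ⟨j, hj, hhalf⟩ := exists_half_le hw hε (n := n) (R := R)
    (by nlinarith) (hM k) hR
  have h1 := sq_le_card_mul_return (w := w) (cube d R) j
  have h2 : (step w)^[2 * j] (ind {0}) 0 ≤ (step w)^[2 * n] (ind {0}) 0 := return_antitone hw hj
  refine le_trans ?_ h2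
  have hcard : ((cube d R).card : ℝ) ≤ (2 * N + 5) ^ d * (n : ℝ) ^ ((d : ℝ) / 2) := by
    have h3 : (n : ℝ) ^ ((d : ℝ) / 2) = √n ^ d := by
      rw [Real.sqrt_eq_rpow, ← Real.rpow_natCast, ← Real.rpow_mul (Nat.cast_nonneg n)]
      congr 1
      ring
    rw [h3, ← mul_pow, card_cube]
    push_cast
    gcongr
    nlinarith
  have hn0 : (0 : ℝ) < (n : ℝ) ^ ((d : ℝ) / 2) := Real.rpow_pos_of_pos (by exact_mod_cast hn) _
  have hv0 := iterate_step_nonneg (w := w) hw (ind_nonneg {0}) (2 * j) 0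
  rw [div_div, div_le_iff₀ (by positivity)]
  nlinarith [mul_le_mul_of_nonneg_right hcard hv0]

end HeatKernel

/-! ### The path law -/

section PathLaw

variable {d : ℕ} {ω : Env d}

lemma unitE_injective : Function.Injective (unitE d) := fun i j h => by
  have := congrFun h i
  by_contra hij
  simp [unitE, hij] at this

lemma unitE_ne_zero (i : Fin d) : unitE d i ≠ 0 := fun h => by
  have := congrFun h i
  simp [unitE] at this

lemma unitE_add_ne_zero (i j : Fin d) : unitE d i + unitE d j ≠ 0 := fun h => by
  have := congrFun h i
  simp only [unitE, Pi.add_apply, if_true, Pi.zero_apply] at this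
  split_ifs at this <;> omega

lemma condOf_add (x : Site d) (i : Fin d) : condOf d ω x (x + unitE d i) = ω (x, i) := by
  have h : ∃ j, x + unitE d i = x + unitE d j := ⟨i, rfl⟩
  rw [condOf, dif_pos h]
  have := unitE_injective (add_left_cancel h.choose_spec)
  rw [← this]

lemma condOf_sub (x : Site d) (i : Fin d) :
    condOf d ω x (x - unitE d i) = ω (x - unitE d i, i) := by
  have h1 : ¬ ∃ j, x - unitE d i = x + unitE d j := by
    rintro ⟨j, hj⟩
    refine unitE_add_ne_zero i j ?_
    rw [sub_eq_iff_eq_add, add_assoc] at hj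
    rw [add_comm]
    exact (left_eq_add.1 hj)
  have h2 : ∃ j, x = x - unitE d i + unitE d j := ⟨i, (sub_add_cancel _ _).symm⟩
  rw [condOf, dif_neg h1, dif_pos h2]
  have h3 : unitE d i = unitE d h2.choose := by
    have h4 := h2.choose_spec
    rw [sub_add_eq_add_sub, eq_sub_iff_add_eq] at h4
    exact add_left_cancel h4
  rw [← unitE_injective h3]

/-- The sites within one step of `x`. -/
def nbhd (x : Site d) : Finset (Site d) :=
  insert x (Finset.univ.image (fun i => x + unitE d i) ∪
    Finset.univ.image fun i => x - unitE d i)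

lemma step_eq_sum (F : Site d → ℝ) (x : Site d) :
    step ω F x = ∑ z ∈ nbhd x, stepProb d ω x z * F z := by
  have hx : x ∉ Finset.univ.image (fun i => x + unitE d i) ∪
      Finset.univ.image fun i => x - unitE d i := by
    simp only [Finset.mem_union, Finset.mem_image, Finset.mem_univ, true_and, not_or, not_exists]
    exact ⟨fun i h => unitE_ne_zero i (by simpa using h),
      fun i h => unitE_ne_zero i (by simpa using h)⟩
  have hdisj : Disjoint (Finset.univ.image fun i => x + unitE d i)
      (Finset.univ.image fun i => x - unitE d i) := by
    rw [Finset.disjoint_left]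
    intro z h1 h2
    obtain ⟨i, -, rfl⟩ := Finset.mem_image.1 h1
    obtain ⟨j, -, hj⟩ := Finset.mem_image.1 h2
    refine unitE_add_ne_zero i j ?_
    rw [sub_eq_iff_eq_add, add_assoc] at hj
    exact left_eq_add.1 hj
  have hself : stepProb d ω x x = 1 - degSum d ω x / (2 * d) := by
    rw [stepProb, if_neg, if_pos rfl]
    rintro (⟨i, h⟩ | ⟨i, h⟩) <;> exact unitE_ne_zero i (left_eq_add.1 h)
  have hadd : ∀ i, stepProb d ω x (x + unitE d i) = ω (x, i) / (2 * d) := fun i => by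
    rw [stepProb, if_pos (show adjacent d _ _ from .inl ⟨i, rfl⟩), condOf_add]
  have hsub : ∀ i, stepProb d ω x (x - unitE d i) = ω (x - unitE d i, i) / (2 * d) := fun i => by
    rw [stepProb, if_pos (show adjacent d _ _ from .inr ⟨i, (sub_add_cancel _ _).symm⟩),
      condOf_sub]
  rw [nbhd, Finset.sum_insert hx, Finset.sum_union hdisj,
    Finset.sum_image fun i _ j _ h => unitE_injective (add_left_cancel h),
    Finset.sum_image fun i _ j _ h => unitE_injective (sub_right_injective h), hself]
  simp only [hadd, hsub, degSum, condOf_add, condOf_sub, step, gen, sub_mul, one_mul,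
    div_mul_eq_mul_div, ← Finset.sum_div, mul_sub, Finset.sum_add_distrib, Finset.sum_sub_distrib, ← Finset.sum_mul]
  ring

lemma stepProb_nonneg (hω : UnitCond ω) (x y : Site d) : 0 ≤ stepProb d ω x y := by
  unfold stepProb
  split_ifs with h1 h2
  · refine div_nonneg ?_ (by positivity)
    rcases h1 with ⟨i, rfl⟩ | ⟨i, rfl⟩
    · rw [condOf_add]
      exact (hω _).1
    · have := condOf_sub (ω := ω) (y + unitE d i) i
      rw [add_sub_cancel_right] at this
      rw [this]
      exact (hω _).1
  · have : degSum d ω x ≤ 2 * d := by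
      unfold degSum
      refine (Finset.sum_le_sum fun i _ => (?_ : _ ≤ (2 : ℝ))).trans (by simp [mul_comm])
      rw [condOf_add, condOf_sub]
      linarith [(hω (x, i)).2, (hω (x - unitE d i, i)).2]
    exact sub_nonneg.2 (div_le_one_of_le₀ this (by positivity))
  · exact le_rfl

/-- Lower bound for the probability of following a given path and then moving to `y`. -/
lemma path_return_ge (hω : UnitCond ω) {z : Site d} {Pz : Measure (ℕ → Site d)}
    (hPz : IsQuenchedLaw d ω z Pz) (y : Site d) (m n : ℕ) (γ : ℕ → Site d) :
    ENNReal.ofReal (((if γ 0 = z then (1 : ℝ) else 0) *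
      ∏ k ∈ Finset.range n, stepProb d ω (γ k) (γ (k + 1))) * (step ω)^[m] (ind {y}) (γ n)) ≤
      Pz {X | (∀ k ≤ n, X k = γ k) ∧ X (n + m) = y} := by
  induction m generalizing n γ with
  | zero =>
    by_cases hy : γ n = y
    · have h1 : {X : ℕ → Site d | (∀ k ≤ n, X k = γ k) ∧ X (n + 0) = y} =
          {X | ∀ k ≤ n, X k = γ k} := by
        ext X
        exact ⟨And.left, fun h => ⟨h, (h n le_rfl).trans hy⟩⟩
      rw [h1, hPz.2]
      simp [ind, hy]
    · simp [ind, hy]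
  | succ m ih =>
    set q : ℝ := (if γ 0 = z then (1 : ℝ) else 0) *
      ∏ k ∈ Finset.range n, stepProb d ω (γ k) (γ (k + 1)) with hq
    have hq0 : 0 ≤ q := mul_nonneg (by split_ifs <;> simp)
      (Finset.prod_nonneg fun _ _ => stepProb_nonneg hω _ _)
    set γ' : Site d → ℕ → Site d := fun u => Function.update γ (n + 1) u with hγ'
    have hγ'1 : ∀ u, γ' u (n + 1) = u := fun u => Function.update_self ..
    have hγ'2 : ∀ u k, k ≤ n → γ' u k = γ k := fun u k hk =>
      Function.update_of_ne (by omega) ..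
    have hset : ∀ u, MeasurableSet {X : ℕ → Site d | (∀ k ≤ n + 1, X k = γ' u k) ∧
        X (n + 1 + m) = y} := fun u => by
      refine MeasurableSet.inter (s₁ := {X : ℕ → Site d | ∀ k ≤ n + 1, X k = γ' u k}) ?_
        (measurableSet_eq_fun (measurable_pi_apply _) measurable_const)
      simp only [Set.ofPred_forall]
      exact .iInter fun k => .iInter fun _ =>
        measurableSet_eq_fun (measurable_pi_apply _) measurable_const
    have hdisj : Set.PairwiseDisjoint (nbhd (γ n) : Set (Site d)) fun u =>
        {X : ℕ → Site d | (∀ k ≤ n + 1, X k = γ' u k) ∧ X (n + 1 + m) = y} := by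
      intro u _ v _ huv
      refine Set.disjoint_left.2 fun X hu hv => huv ?_
      rw [← hγ'1 u, ← hγ'1 v, ← hu.1 _ le_rfl, ← hv.1 _ le_rfl]
    have hsub : (⋃ u ∈ nbhd (γ n), {X : ℕ → Site d | (∀ k ≤ n + 1, X k = γ' u k) ∧
        X (n + 1 + m) = y}) ⊆ {X | (∀ k ≤ n, X k = γ k) ∧ X (n + (m + 1)) = y} := by
      intro X hX
      obtain ⟨u, -, h1, h2⟩ := Set.mem_iUnion₂.1 hX
      refine ⟨fun k hk => (h1 k (by omega)).trans (hγ'2 u k hk), ?_⟩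
      rw [← h2]
      congr 1
      omega
    refine le_trans ?_ (measure_mono hsub)
    rw [measure_biUnion_finset hdisj fun u _ => hset u]
    refine le_trans ?_ (Finset.sum_le_sum fun u _ => ih (n + 1) (γ' u))
    have hterm : ∀ u, ((if γ' u 0 = z then (1 : ℝ) else 0) *
        ∏ k ∈ Finset.range (n + 1), stepProb d ω (γ' u k) (γ' u (k + 1))) *
        (step ω)^[m] (ind {y}) (γ' u (n + 1)) =
        q * (stepProb d ω (γ n) u * (step ω)^[m] (ind {y}) u) := by
      intro u
      rw [Finset.prod_range_succ, hγ'1, hγ'2 u n le_rfl, hγ'2 u 0 (Nat.zero_le n),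
        Finset.prod_congr rfl fun k hk => by
          rw [hγ'2 u k (Finset.mem_range.1 hk).le, hγ'2 u (k + 1) (Finset.mem_range.1 hk)]]
      rw [hq]
      ring
    simp only [hterm]
    rw [← ENNReal.ofReal_sum_of_nonneg fun u _ => mul_nonneg hq0 (mul_nonneg
      (stepProb_nonneg hω _ _) (iterate_step_nonneg hω (ind_nonneg _) m u)), ← Finset.mul_sum,
      ← step_eq_sum, ← Function.iterate_succ_apply' (step ω)]

lemma return_le_path_law (hω : UnitCond ω) {Pz : Measure (ℕ → Site d)}
    (hPz : IsQuenchedLaw d ω 0 Pz) (m : ℕ) :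
    (step ω)^[m] (ind {0}) 0 ≤ (Pz {X | X m = 0}).toReal := by
  have := hPz.1
  have h := path_return_ge hω hPz 0 m 0 0
  have h2 := h.trans (measure_mono (t := {X | X m = 0}) fun X hX => by simpa using hX.2)
  rw [Finset.range_zero, Finset.prod_empty, Pi.zero_apply, if_pos rfl, one_mul, one_mul] at h2
  exact (ENNReal.ofReal_le_iff_le_toReal (measure_ne_top _ _)).1 h2

end PathLaw

/-! ### Invariance of the environment under shifts -/

section Invariance

variable {d : ℕ} {μ : Measure ℝ} {P : Measure (Env d)}

lemma IsIIDLaw.eq {ι : Type*} {Q : Measure (ι → ℝ)} {μ : Measure ℝ} [IsProbabilityMeasure μ]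
    (hQ : IsIIDLaw Q μ) : Q = Measure.infinitePi fun _ => μ := by
  refine Measure.eq_infinitePi _ fun s t ht => ?_
  rw [← hQ.2 s t ht]
  rfl

lemma IsIIDLaw.map_shiftBy [IsProbabilityMeasure μ] (hP : IsIIDLaw P μ) (z : Site d) :
    P.map (shiftBy d z) = P := by
  have := hP.1
  have hm : Measurable (shiftBy d z) := measurable_shiftBy z
  suffices h : IsIIDLaw (P.map (shiftBy d z)) μ by rw [h.eq, hP.eq]
  refine ⟨Measure.isProbabilityMeasure_map hm.aemeasurable, fun s f hf => ?_⟩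
  have hms : MeasurableSet {ω : Env d | ∀ i ∈ s, ω i ∈ f i} := by
    simp only [Set.ofPred_forall]
    exact .iInter fun i => .iInter fun _ => measurable_pi_apply i (hf i)
  rw [Measure.map_apply hm hms]
  set e : Edge d ≃ Edge d := (Equiv.addRight z).prodCongr (Equiv.refl _) with he
  have h := hP.2 (s.map e.toEmbedding) (fun i => f (e.symm i)) fun i => hf _
  rw [Finset.prod_map] at h
  simp only [Finset.forall_mem_map, Equiv.coe_toEmbedding, Equiv.symm_apply_apply] at h
  exact h

lemma IsIIDLaw.ae_unitCond (hP : IsIIDLaw P μ) (hsupp : μ (Set.Icc (0 : ℝ) 1)ᶜ = 0) :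
    ∀ᵐ ω ∂P, UnitCond ω := by
  refine ae_all_iff.2 fun e => ?_
  have h := hP.2 {e} (fun _ => (Set.Icc (0 : ℝ) 1)ᶜ) fun _ => measurableSet_Icc.compl
  rw [Finset.prod_singleton, hsupp] at h
  rw [ae_iff]
  simpa using h

end Invariance

/-- **Remark 1.2** (heat-kernel lower bound).  Let `d ≥ 2` and `P(ω_b > 0) > p_c(d)`.
Then almost surely on `{0 ∈ C∞}` there exists `C(ω) > 0` such that the return
probability satisfies `P_{ω,0}(X_{2n} = 0) ≥ C(ω)/n^{d/2}` for all `n ≥ 1`. -/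
theorem statement18 (d : ℕ) (hd : 2 ≤ d)
    (μ : Measure ℝ) [IsProbabilityMeasure μ] (hsupp : μ (Set.Icc (0 : ℝ) 1)ᶜ = 0)
    (P : Measure (Env d)) (hP : IsIIDLaw P μ)
    (hperc : pc d < (μ {x : ℝ | 0 < x}).toReal) :
    ∀ᵐ ω ∂(ProbabilityTheory.cond P {ω' | (0 : Site d) ∈ Cinf d ω'}),
      ∀ Pz : Measure (ℕ → Site d), IsQuenchedLaw d ω 0 Pz →
        ∃ C : ℝ, 0 < C ∧ ∀ n : ℕ, 1 ≤ n →
          C / (n : ℝ) ^ ((d : ℝ) / 2) ≤ (Pz {X | X (2 * n) = 0}).toReal := by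
  have := hP.1
  refine cond_absolutelyContinuous.ae_le ?_
  filter_upwards [hP.ae_unitCond hsupp,
    ae_all_iff.2 (ae_exists_geoAvg_sq_le (P := P) hP.map_shiftBy)] with ω hω hM Pz hPz
  choose M hM using hM
  rw [clamp_eq_self hω] at hM
  obtain ⟨C, hC, h⟩ := exists_return_ge hω (M := ∑ c, |M c|) fun k c =>
    (hM c k).trans ((le_abs_self _).trans
      (Finset.single_le_sum (f := fun c => |M c|) (fun c _ => abs_nonneg _) (Finset.mem_univ c)))
  exact ⟨C, hC, fun n hn => (h n hn).trans (return_le_path_law hω hPz (2 * n))⟩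

end RCRW
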